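/- arXiv:0809.3199 — 2 statements merged into one kernel-verified Lean document; each statement's English description precedes it below -/
import Mathlib

section
/- Let d ≥ 1, ε > 0, λ ∈ ℝ, and let the components of A : ℝ^d → ℝ^d be of class C^∞_pol. Then for all φ, ψ ∈ S(ℝ^d), the magnetic Wigner transform W^A_{ε,λ}(φ,ψ)(x,ξ) := ∫_{ℝ^d} e^{-i y·ξ} e^{-iλ Γ^A_ε([x/ε − y/2, x/ε + y/2])} conj(φ(x/ε − y/2)) ψ(x/ε + y/2) dy is a Schwartz function on ℝ^{2d}, i.e. W^A_{ε,λ}(φ,ψ) ∈ S(ℝ^d × ℝ^d). -/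
noncomputable section
open MeasureTheory Complex

/-- `ℝ^d` -/
abbrev Vd (d : ℕ) := Fin d → ℝ

/-- Euclidean dot product. -/
def dotR {d : ℕ} (x y : Vd d) : ℝ := ∑ l, x l * y l

/-- Circulation `Γ^A([u,v]) = Σ_l (v_l - u_l) ∫_0^1 A_l(u + s(v-u)) ds`. -/
def circA {d : ℕ} (A : Vd d → Vd d) (u v : Vd d) : ℝ :=
  ∑ l, (v l - u l) * ∫ s in (0:ℝ)..1, A (u + s • (v - u)) l

/-- The `ε`-scaled circulation `Γ^A_ε([u,v]) := (1/ε) Γ^A([εu,εv])`. -/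
def circAe {d : ℕ} (ε : ℝ) (A : Vd d → Vd d) (u v : Vd d) : ℝ :=
  ε⁻¹ * circA A (ε • u) (ε • v)

/-- A function is of class `C^∞_pol` if it is smooth and it together with all its
derivatives is polynomially bounded. -/
def CPol {E F : Type*} [NormedAddCommGroup E] [NormedSpace ℝ E]
    [NormedAddCommGroup F] [NormedSpace ℝ F] (f : E → F) : Prop :=
  ContDiff ℝ (⊤ : ℕ∞) f ∧
    ∀ n : ℕ, ∃ (C : ℝ) (k : ℕ), ∀ x, ‖iteratedFDeriv ℝ n f x‖ ≤ C * (1 + ‖x‖) ^ k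

/-- Magnetic Weyl quantization in the adiabatic scaling:
`(Op^A_{ε,λ}(f)φ)(x) = (2π)^{-d} ∫∫ e^{-i(y-x)·η} e^{-iλΓ^A_ε([x,y])} f((ε/2)(x+y),η) φ(y) dy dη`. -/
def mOp {d : ℕ} (ε lam : ℝ) (A : Vd d → Vd d) (f : Vd d × Vd d → ℂ)
    (φ : Vd d → ℂ) (x : Vd d) : ℂ :=
  (((2 * Real.pi) ^ d)⁻¹ : ℝ) * ∫ y : Vd d, ∫ η : Vd d,
    Complex.exp (-Complex.I * dotR (y - x) η) *
      Complex.exp (-Complex.I * lam * circAe ε A x y) *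
      f ((ε / 2) • (x + y), η) * φ y

/-- The magnetic Wigner transform `W^A_{ε,λ}(φ,ψ)`. -/
def mWig {d : ℕ} (ε lam : ℝ) (A : Vd d → Vd d) (φ ψ : Vd d → ℂ)
    (X : Vd d × Vd d) : ℂ :=
  ∫ y : Vd d,
    Complex.exp (-Complex.I * dotR y X.2) *
      Complex.exp (-Complex.I * lam *
        circAe ε A (ε⁻¹ • X.1 - (2:ℝ)⁻¹ • y) (ε⁻¹ • X.1 + (2:ℝ)⁻¹ • y)) *
      (starRingEnd ℂ) (φ (ε⁻¹ • X.1 - (2:ℝ)⁻¹ • y)) * ψ (ε⁻¹ • X.1 + (2:ℝ)⁻¹ • y)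

open Set
open scoped LineDeriv

theorem Function.HasTemperateGrowth.hasTemperateGrowth_fderiv {E F : Type*}
    [NormedAddCommGroup E] [NormedSpace ℝ E]
    [NormedAddCommGroup F] [NormedSpace ℝ F] {f : E → F} (hf : f.HasTemperateGrowth) :
    (fderiv ℝ f).HasTemperateGrowth := by
  refine ⟨hf.1.fderiv_right (by simp), fun n ↦ ?_⟩
  obtain ⟨k, C, h⟩ := hf.2 (n + 1)
  exact ⟨k, C, fun x ↦ norm_iteratedFDeriv_fderiv (𝕜 := ℝ) (f := f) ▸ h x⟩

/-- A temperate function on `ℝ × E` grows polynomially in the second variable, uniformly for the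
first variable in the unit interval. -/
theorem Function.HasTemperateGrowth.exists_norm_le_of_mem_uIoc {E F : Type*}
    [NormedAddCommGroup E] [NormedSpace ℝ E] [NormedAddCommGroup F] [NormedSpace ℝ F]
    {H : ℝ × E → F} (hH : H.HasTemperateGrowth) :
    ∃ (k : ℕ) (C : ℝ), 0 ≤ C ∧ ∀ s ∈ uIoc (0 : ℝ) 1, ∀ x, ‖H (s, x)‖ ≤ C * (1 + ‖x‖) ^ k := by
  obtain ⟨k, C, hC, h⟩ := hH.norm_iteratedFDeriv_le_uniform 0
  refine ⟨k, C * 2 ^ k, by positivity, fun s hs x ↦ ?_⟩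
  have h0 := h 0 le_rfl (s, x)
  rw [norm_iteratedFDeriv_zero] at h0
  rw [uIoc_of_le zero_le_one] at hs
  have hs' : ‖s‖ ≤ 1 := by rw [Real.norm_eq_abs, abs_le]; constructor <;> linarith [hs.1, hs.2]
  have hx : 1 + ‖(s, x)‖ ≤ 2 * (1 + ‖x‖) := by
    have : ‖(s, x)‖ ≤ 1 + ‖x‖ := max_le (by linarith [norm_nonneg x]) (by simp)
    linarith [norm_nonneg x]
  calc _ ≤ C * (1 + ‖(s, x)‖) ^ k := h0
    _ ≤ C * (2 * (1 + ‖x‖)) ^ k := by gcongr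
    _ = _ := by rw [mul_pow, mul_assoc]

theorem Function.HasTemperateGrowth.fderiv_comp_inr {E F : Type*}
    [NormedAddCommGroup E] [NormedSpace ℝ E] [NormedAddCommGroup F] [NormedSpace ℝ F]
    {H : ℝ × E → F} (hH : H.HasTemperateGrowth) :
    (fun z ↦ (fderiv ℝ H z).comp (ContinuousLinearMap.inr ℝ ℝ E)).HasTemperateGrowth :=
  (((ContinuousLinearMap.compL ℝ E (ℝ × E) F).flip
    (ContinuousLinearMap.inr ℝ ℝ E)).hasTemperateGrowth).comp hH.hasTemperateGrowth_fderiv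

theorem Function.HasTemperateGrowth.hasFDerivAt_intervalIntegral {E F : Type*}
    [NormedAddCommGroup E] [NormedSpace ℝ E] [NormedAddCommGroup F] [NormedSpace ℝ F]
    {H : ℝ × E → F} (hH : H.HasTemperateGrowth) (x : E) :
    HasFDerivAt (fun x ↦ ∫ s in (0 : ℝ)..1, H (s, x))
      (∫ s in (0 : ℝ)..1, (fderiv ℝ H (s, x)).comp (ContinuousLinearMap.inr ℝ ℝ E)) x := by
  have hH' := hH.fderiv_comp_inr
  obtain ⟨k, C, hC, hb⟩ := hH'.exists_norm_le_of_mem_uIoc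
  refine intervalIntegral.hasFDerivAt_integral_of_dominated_of_fderiv_le
    (bound := fun _ ↦ C * (1 + (‖x‖ + 1)) ^ k)
    (F' := fun x s ↦ (fderiv ℝ H (s, x)).comp (ContinuousLinearMap.inr ℝ ℝ E))
    (Metric.ball_mem_nhds x one_pos) ?_ ?_ ?_ ?_ ?_ ?_
  · exact .of_forall fun x ↦ (hH.1.continuous.comp (by fun_prop)).aestronglyMeasurable
  · exact (hH.1.continuous.comp (by fun_prop)).intervalIntegrable _ _
  · exact (hH'.1.continuous.comp (by fun_prop : Continuous fun s : ℝ ↦ (s, x))).aestronglyMeasurable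
  · refine .of_forall fun s hs z hz ↦ (hb s hs z).trans ?_
    have : ‖z‖ ≤ ‖x‖ + 1 := by
      have := norm_le_norm_add_norm_sub' z x
      rw [Metric.mem_ball, dist_eq_norm] at hz
      linarith
    gcongr
  · exact intervalIntegrable_const
  · refine .of_forall fun s _ z _ ↦ ?_
    exact (hH.1.differentiable (by simp) (s, z)).hasFDerivAt.comp z (hasFDerivAt_prodMk_right s z)

universe u

theorem Function.HasTemperateGrowth.intervalIntegral {E F : Type u}
    [NormedAddCommGroup E] [NormedSpace ℝ E] [NormedAddCommGroup F] [NormedSpace ℝ F]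
    {H : ℝ × E → F} (hH : H.HasTemperateGrowth) :
    (fun x ↦ ∫ s in (0 : ℝ)..1, H (s, x)).HasTemperateGrowth := by
  have key (n : ℕ) : ContDiff ℝ n (fun x ↦ ∫ s in (0 : ℝ)..1, H (s, x)) ∧
      ∃ (k : ℕ) (C : ℝ), ∀ x,
        ‖iteratedFDeriv ℝ n (fun x ↦ ∫ s in (0 : ℝ)..1, H (s, x)) x‖ ≤ C * (1 + ‖x‖) ^ k := by
    induction n generalizing F with
    | zero =>
      refine ⟨contDiff_zero.2 <| continuous_iff_continuousAt.2 fun x ↦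
        (hH.hasFDerivAt_intervalIntegral x).continuousAt, ?_⟩
      obtain ⟨k, C, -, h⟩ := hH.exists_norm_le_of_mem_uIoc
      refine ⟨k, C, fun x ↦ ?_⟩
      rw [norm_iteratedFDeriv_zero]
      simpa using intervalIntegral.norm_integral_le_of_norm_le_const fun s hs ↦ h s hs x
    | succ n ih =>
      obtain ⟨h1, k, C, h2⟩ := ih hH.fderiv_comp_inr
      refine ⟨contDiff_succ_iff_hasFDerivAt.2 ⟨_, h1, hH.hasFDerivAt_intervalIntegral⟩, k, C,
        fun x ↦ ?_⟩
      rw [← norm_iteratedFDeriv_fderiv, funext fun x ↦ (hH.hasFDerivAt_intervalIntegral x).fderiv]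
      exact h2 x
  exact ⟨contDiff_infty.2 fun n ↦ (key n).1, fun n ↦ (key n).2⟩

/-- The bilinear form `dotR`, as a continuous bilinear map. -/
def dotCLM (d : ℕ) : Vd d →L[ℝ] Vd d →L[ℝ] ℝ :=
  ∑ l, (ContinuousLinearMap.mul ℝ ℝ).bilinearComp (ContinuousLinearMap.proj l)
    (ContinuousLinearMap.proj l)

theorem dotCLM_apply {d : ℕ} (x y : Vd d) : dotCLM d x y = dotR x y := by
  simp [dotCLM, dotR]

section PartialFourier

variable {d : ℕ} {E F : Type*} [NormedAddCommGroup E] [NormedSpace ℝ E]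
  [NormedAddCommGroup F] [NormedSpace ℂ F]

/-- The partial Fourier transform, in the second variable, of a function on `E × ℝ^d`. -/
def partialFourier (K : E × Vd d → F) (X : E × Vd d) : F :=
  ∫ y : Vd d, Complex.exp (-Complex.I * dotR y X.2) • K (X.1, y)

theorem norm_exp_neg_I_mul_ofReal (t : ℝ) : ‖Complex.exp (-(Complex.I * t))‖ = 1 := by
  rw [show -(Complex.I * (t : ℂ)) = ((-t : ℝ) : ℂ) * Complex.I by push_cast; ring]
  exact Complex.norm_exp_ofReal_mul_I _

theorem SchwartzMap.exists_norm_pow_mul_norm_le (K : SchwartzMap (E × Vd d) F) (m : ℕ) :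
    ∃ C, ∀ x y, ‖x‖ ^ m * ‖K (x, y)‖ ≤
      C * (1 + ‖y‖) ^ (-((volume : Measure (Vd d)).integrablePower : ℝ)) := by
  set N := (volume : Measure (Vd d)).integrablePower
  refine ⟨2 ^ (m + N) * (Finset.Iic (m + N, 0)).sup
    (fun m ↦ SchwartzMap.seminorm ℝ m.1 m.2) K, fun x y ↦ ?_⟩
  have h := SchwartzMap.one_add_le_sup_seminorm_apply (𝕜 := ℝ) (m := (m + N, 0))
    (k := m + N) (n := 0) le_rfl le_rfl K (x, y)
  rw [norm_iteratedFDeriv_zero] at h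
  have hy : 0 < 1 + ‖y‖ := by positivity
  rw [Real.rpow_neg hy.le, Real.rpow_natCast, ← div_eq_mul_inv, le_div_iff₀ (by positivity)]
  refine le_trans ?_ h
  have hx : ‖x‖ ≤ 1 + ‖(x, y)‖ := (norm_fst_le (x, y)).trans (by linarith)
  have hy : ‖y‖ ≤ ‖(x, y)‖ := norm_snd_le (x, y)
  calc ‖x‖ ^ m * ‖K (x, y)‖ * (1 + ‖y‖) ^ N
      ≤ (1 + ‖(x, y)‖) ^ m * ‖K (x, y)‖ * (1 + ‖(x, y)‖) ^ N := by gcongr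
    _ = _ := by rw [pow_add]; ring

theorem SchwartzMap.integrable_partialFourier (K : SchwartzMap (E × Vd d) F) (X : E × Vd d) :
    Integrable fun y : Vd d ↦ Complex.exp (-Complex.I * dotR y X.2) • K (X.1, y) := by
  obtain ⟨C, hC⟩ := K.exists_norm_pow_mul_norm_le 0
  refine ((Measure.integrable_pow_neg_integrablePower _).const_mul C).mono' ?_
    (.of_forall fun y ↦ ?_)
  · have := K.continuous
    simp_rw [← dotCLM_apply]
    exact Continuous.aestronglyMeasurable (by fun_prop)
  · simpa [norm_smul, norm_exp_neg_I_mul_ofReal] using hC X.1 y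

/-- The Schwartz function whose partial Fourier transform is the derivative of the partial
Fourier transform of `K`. -/
def SchwartzMap.partialFourierDeriv (K : SchwartzMap (E × Vd d) F) :
    SchwartzMap (E × Vd d) (E × Vd d →L[ℝ] F) :=
  SchwartzMap.postcompCLM ((ContinuousLinearMap.compL ℝ (E × Vd d) (E × Vd d) F).flip
      ((ContinuousLinearMap.inl ℝ E (Vd d)).comp (ContinuousLinearMap.fst ℝ E (Vd d))))
    (SchwartzMap.fderivCLM ℝ (E × Vd d) F K) +
  SchwartzMap.smulRightCLM ℝ F ((dotCLM d).bilinearComp (ContinuousLinearMap.snd ℝ E (Vd d))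
    (ContinuousLinearMap.snd ℝ E (Vd d))) (-Complex.I • K)

theorem SchwartzMap.hasFDerivAt_partialFourier (K : SchwartzMap (E × Vd d) F) (X : E × Vd d) :
    HasFDerivAt (partialFourier K) (partialFourier K.partialFourierDeriv X) X := by
  obtain ⟨C, hC⟩ := K.partialFourierDeriv.exists_norm_pow_mul_norm_le 0
  refine hasFDerivAt_integral_of_dominated_of_fderiv_le
    (bound := fun y ↦ C * (1 + ‖y‖) ^ (-((volume : Measure (Vd d)).integrablePower : ℝ)))
    (F' := fun X y ↦ Complex.exp (-Complex.I * dotR y X.2) • K.partialFourierDeriv (X.1, y))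
    Filter.univ_mem ?_ ?_ ?_ ?_ ?_ ?_
  · exact .of_forall fun X ↦ (K.integrable_partialFourier X).aestronglyMeasurable
  · exact K.integrable_partialFourier X
  · exact (K.partialFourierDeriv.integrable_partialFourier X).aestronglyMeasurable
  · refine .of_forall fun y X _ ↦ ?_
    simpa [norm_smul, norm_exp_neg_I_mul_ofReal] using hC X.1 y
  · exact (Measure.integrable_pow_neg_integrablePower _).const_mul C
  · refine .of_forall fun y X _ ↦ ?_
    have h1 : HasFDerivAt (fun X : E × Vd d ↦ K (X.1, y))
        ((fderiv ℝ K (X.1, y)).comp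
          ((ContinuousLinearMap.inl ℝ E (Vd d)).comp (ContinuousLinearMap.fst ℝ E (Vd d)))) X :=
      (K.hasFDerivAt (X.1, y)).comp X
        ((hasFDerivAt_prodMk_left (𝕜 := ℝ) X.1 y).comp (f := Prod.fst) X hasFDerivAt_fst)
    have h2 : HasFDerivAt (fun X : E × Vd d ↦ Complex.exp (-Complex.I * dotR y X.2))
        (Complex.exp (-Complex.I * dotR y X.2) • (-Complex.I • (Complex.ofRealCLM.comp
          ((dotCLM d y).comp (ContinuousLinearMap.snd ℝ E (Vd d)))))) X := by
      have := (Complex.ofRealCLM.comp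
          ((dotCLM d y).comp (ContinuousLinearMap.snd ℝ E (Vd d)))).hasFDerivAt (x := X)
      simpa [dotCLM_apply] using (this.const_mul (-Complex.I)).cexp
    refine (h2.smul h1).congr_fderiv ?_
    ext v <;>
    · simp [SchwartzMap.partialFourierDeriv, dotCLM_apply]
      rw [mul_smul, mul_smul, Complex.coe_smul, smul_comm Complex.I]

theorem SchwartzMap.smul_partialFourier (K : SchwartzMap (E × Vd d) F) (X : E × Vd d) (j : Fin d) :
    (Complex.I * X.2 j) • partialFourier K X =
      partialFourier (∂_{((0 : E), (Pi.single j 1 : Vd d))} K : SchwartzMap (E × Vd d) F) X := by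
  have hexp (y : Vd d) : HasFDerivAt (fun y ↦ Complex.exp (-Complex.I * dotR y X.2))
      (Complex.exp (-Complex.I * dotR y X.2) • (-Complex.I • (Complex.ofRealCLM.comp
        ((dotCLM d).flip X.2)))) y := by
    have := (Complex.ofRealCLM.comp ((dotCLM d).flip X.2)).hasFDerivAt (x := y)
    simpa [dotCLM_apply] using (this.const_mul (-Complex.I)).cexp
  have hK (y : Vd d) : HasFDerivAt (fun y ↦ K (X.1, y))
      ((fderiv ℝ K (X.1, y)).comp (ContinuousLinearMap.inr ℝ E (Vd d))) y :=
    (K.hasFDerivAt (X.1, y)).comp y (hasFDerivAt_prodMk_right X.1 y)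
  have hexp' (y : Vd d) : fderiv ℝ (fun y ↦ Complex.exp (-Complex.I * dotR y X.2)) y
      (Pi.single j 1) = -(Complex.I * X.2 j) * Complex.exp (-Complex.I * dotR y X.2) := by
    rw [(hexp y).fderiv]
    simp [dotCLM_apply, dotR, Pi.single_apply]
    ring
  have hK' (y : Vd d) : fderiv ℝ (fun y ↦ K (X.1, y)) y (Pi.single j 1) =
      (∂_{((0 : E), (Pi.single j 1 : Vd d))} K : SchwartzMap (E × Vd d) F) (X.1, y) := by
    rw [(hK y).fderiv, SchwartzMap.lineDerivOp_apply_eq_fderiv]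
    simp
  have key := integral_smul_fderiv_eq_neg_fderiv_smul_of_integrable (μ := volume)
    (f := fun y ↦ Complex.exp (-Complex.I * dotR y X.2)) (g := fun y ↦ K (X.1, y))
    (v := Pi.single j 1) ?_ ?_ (K.integrable_partialFourier X)
    (fun y _ ↦ (hexp y).differentiableAt) (fun y _ ↦ (hK y).differentiableAt)
  · simp only [hexp', hK', mul_smul, neg_smul, integral_neg, integral_smul, neg_neg] at key
    rw [mul_smul]
    exact key.symm
  · simp only [hexp', mul_smul (-(Complex.I * (X.2 j : ℂ)))]
    exact (K.integrable_partialFourier X).smul (-(Complex.I * (X.2 j : ℂ)))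
  · simp only [hK']
    exact SchwartzMap.integrable_partialFourier _ X

theorem SchwartzMap.exists_norm_fst_pow_mul_norm_partialFourier_le
    (K : SchwartzMap (E × Vd d) F) (k : ℕ) :
    ∃ C, ∀ X, ‖X.1‖ ^ k * ‖partialFourier K X‖ ≤ C := by
  obtain ⟨C, hC⟩ := K.exists_norm_pow_mul_norm_le k
  refine ⟨∫ y : Vd d, C * (1 + ‖y‖) ^ (-((volume : Measure (Vd d)).integrablePower : ℝ)),
    fun X ↦ ?_⟩
  have : ‖X.1‖ ^ k * ‖partialFourier K X‖ = ‖∫ y : Vd d,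
      ((‖X.1‖ : ℂ) ^ k) • Complex.exp (-Complex.I * dotR y X.2) • K (X.1, y)‖ := by
    rw [integral_smul, norm_smul]
    simp [partialFourier]
  rw [this]
  refine norm_integral_le_of_norm_le
    ((Measure.integrable_pow_neg_integrablePower _).const_mul C) (.of_forall fun y ↦ ?_)
  simpa [norm_smul, norm_exp_neg_I_mul_ofReal] using hC X.1 y

theorem SchwartzMap.exists_norm_snd_pow_mul_norm_partialFourier_le
    (K : SchwartzMap (E × Vd d) F) (k : ℕ) :
    ∃ C, ∀ X, ‖X.2‖ ^ k * ‖partialFourier K X‖ ≤ C := by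
  induction k generalizing K with
  | zero => simpa using K.exists_norm_fst_pow_mul_norm_partialFourier_le 0
  | succ k ih =>
    choose C hC using fun j : Fin d ↦ ih (∂_{((0 : E), (Pi.single j 1 : Vd d))} K)
    refine ⟨∑ j, C j, fun X ↦ ?_⟩
    calc ‖X.2‖ ^ (k + 1) * ‖partialFourier K X‖
        ≤ ‖X.2‖ ^ k * (∑ j, ‖X.2 j‖) * ‖partialFourier K X‖ := by
          rw [pow_succ]
          gcongr
          exact (pi_norm_le_iff_of_nonneg (by positivity)).2 fun j ↦
            Finset.single_le_sum (fun i _ ↦ norm_nonneg (X.2 i)) (Finset.mem_univ j)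
      _ = ∑ j, ‖X.2‖ ^ k * ‖(Complex.I * X.2 j) • partialFourier K X‖ := by
          simp [norm_smul, Finset.mul_sum, Finset.sum_mul, mul_assoc]
      _ ≤ ∑ j, C j := by
          gcongr with j
          rw [K.smul_partialFourier]
          exact hC j X

theorem SchwartzMap.exists_norm_pow_mul_norm_partialFourier_le
    (K : SchwartzMap (E × Vd d) F) (k : ℕ) :
    ∃ C, ∀ X, ‖X‖ ^ k * ‖partialFourier K X‖ ≤ C := by
  obtain ⟨C₁, h₁⟩ := K.exists_norm_fst_pow_mul_norm_partialFourier_le k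
  obtain ⟨C₂, h₂⟩ := K.exists_norm_snd_pow_mul_norm_partialFourier_le k
  refine ⟨max C₁ C₂, fun X ↦ ?_⟩
  rcases max_choice ‖X.1‖ ‖X.2‖ with h | h <;> rw [Prod.norm_def, h]
  exacts [(h₁ X).trans (le_max_left _ _), (h₂ X).trans (le_max_right _ _)]

end PartialFourier

/-- The partial Fourier transform of a Schwartz function is a Schwartz function. -/
def SchwartzMap.partialFourierTransform {d : ℕ} {E F : Type u} [NormedAddCommGroup E]
    [NormedSpace ℝ E] [NormedAddCommGroup F] [NormedSpace ℂ F] (K : SchwartzMap (E × Vd d) F) :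
    SchwartzMap (E × Vd d) F where
  toFun := partialFourier K
  smooth' := by
    refine contDiff_infty.2 fun n ↦ ?_
    induction n generalizing F with
    | zero =>
      exact contDiff_zero.2 <| continuous_iff_continuousAt.2 fun X ↦
        (K.hasFDerivAt_partialFourier X).continuousAt
    | succ n ih =>
      exact contDiff_succ_iff_hasFDerivAt.2
        ⟨_, ih K.partialFourierDeriv, K.hasFDerivAt_partialFourier⟩
  decay' k n := by
    induction n generalizing F with
    | zero => simpa using K.exists_norm_pow_mul_norm_partialFourier_le k
    | succ n ih =>
      obtain ⟨C, hC⟩ := ih K.partialFourierDeriv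
      refine ⟨C, fun X ↦ ?_⟩
      rw [← norm_iteratedFDeriv_fderiv, funext fun X ↦ (K.hasFDerivAt_partialFourier X).fderiv]
      exact hC X

theorem ContinuousLinearMap.norm_iteratedFDeriv_comp_right_le {D E F : Type*}
    [NormedAddCommGroup D] [NormedSpace ℝ D] [NormedAddCommGroup E] [NormedSpace ℝ E]
    [NormedAddCommGroup F] [NormedSpace ℝ F] (L : D →L[ℝ] E) (hL : ‖L‖ ≤ 1) {f : E → F} {n : ℕ}
    (hf : ContDiff ℝ n f) (x : D) :
    ‖iteratedFDeriv ℝ n (fun y ↦ f (L y)) x‖ ≤ ‖iteratedFDeriv ℝ n f (L x)‖ := by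
  change ‖iteratedFDeriv ℝ n (f ∘ L) x‖ ≤ _
  rw [L.iteratedFDeriv_comp_right hf x le_rfl]
  refine (ContinuousMultilinearMap.norm_compContinuousLinearMap_le _ _).trans ?_
  refine mul_le_of_le_one_right (norm_nonneg _) (Finset.prod_le_one (by simp) (by simp [hL]))

/-- The tensor product of two Schwartz functions. -/
def SchwartzMap.tensor {D E : Type*} [NormedAddCommGroup D] [NormedSpace ℝ D]
    [NormedAddCommGroup E] [NormedSpace ℝ E] (f : SchwartzMap D ℂ) (g : SchwartzMap E ℂ) :
    SchwartzMap (D × E) ℂ where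
  toFun z := f z.1 * g z.2
  smooth' := ((f.smooth _).comp contDiff_fst).mul ((g.smooth _).comp contDiff_snd)
  decay' k n := by
    refine ⟨∑ i ∈ Finset.range (n + 1), (n.choose i : ℝ) *
      (SchwartzMap.seminorm ℝ k i f * SchwartzMap.seminorm ℝ 0 (n - i) g +
        SchwartzMap.seminorm ℝ 0 i f * SchwartzMap.seminorm ℝ k (n - i) g), fun z ↦ ?_⟩
    have hz : ‖z‖ ^ k ≤ ‖z.1‖ ^ k + ‖z.2‖ ^ k := by
      rcases max_choice ‖z.1‖ ‖z.2‖ with h | h <;> rw [Prod.norm_def, h]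
      exacts [le_add_of_nonneg_right (by positivity), le_add_of_nonneg_left (by positivity)]
    have hfs (i : ℕ) : ‖iteratedFDeriv ℝ i (fun z : D × E ↦ f z.1) z‖ ≤
        ‖iteratedFDeriv ℝ i f z.1‖ :=
      (ContinuousLinearMap.fst ℝ D E).norm_iteratedFDeriv_comp_right_le
        (ContinuousLinearMap.norm_fst_le _ _ _) (f.smooth i) z
    have hgs (i : ℕ) : ‖iteratedFDeriv ℝ i (fun z : D × E ↦ g z.2) z‖ ≤
        ‖iteratedFDeriv ℝ i g z.2‖ :=
      (ContinuousLinearMap.snd ℝ D E).norm_iteratedFDeriv_comp_right_le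
        (ContinuousLinearMap.norm_snd_le _ _ _) (g.smooth i) z
    calc ‖z‖ ^ k * ‖iteratedFDeriv ℝ n (fun z : D × E ↦ f z.1 * g z.2) z‖
        ≤ (‖z.1‖ ^ k + ‖z.2‖ ^ k) * ∑ i ∈ Finset.range (n + 1), (n.choose i : ℝ) *
            ‖iteratedFDeriv ℝ i f z.1‖ * ‖iteratedFDeriv ℝ (n - i) g z.2‖ := by
          gcongr
          refine (norm_iteratedFDeriv_mul_le (N := n) ((f.smooth n).comp contDiff_fst)
            ((g.smooth n).comp contDiff_snd) z le_rfl).trans ?_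
          gcongr with i
          exacts [hfs i, hgs _]
      _ = ∑ i ∈ Finset.range (n + 1), (n.choose i : ℝ) *
            ((‖z.1‖ ^ k * ‖iteratedFDeriv ℝ i f z.1‖) *
              (‖z.2‖ ^ 0 * ‖iteratedFDeriv ℝ (n - i) g z.2‖) +
            (‖z.1‖ ^ 0 * ‖iteratedFDeriv ℝ i f z.1‖) *
              (‖z.2‖ ^ k * ‖iteratedFDeriv ℝ (n - i) g z.2‖)) := by
          rw [Finset.mul_sum]
          refine Finset.sum_congr rfl fun i _ ↦ ?_
          ring
      _ ≤ _ := by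
          gcongr <;> exact SchwartzMap.le_seminorm ℝ _ _ _ _

theorem SchwartzMap.tensor_apply {D E : Type*} [NormedAddCommGroup D] [NormedSpace ℝ D]
    [NormedAddCommGroup E] [NormedSpace ℝ E] (f : SchwartzMap D ℂ) (g : SchwartzMap E ℂ)
    (z : D × E) : f.tensor g z = f z.1 * g z.2 := rfl

theorem hasTemperateGrowth_cexp_neg_I_mul (r : ℝ) :
    (fun t : ℝ ↦ Complex.exp (-Complex.I * r * t)).HasTemperateGrowth := by
  have hd (n : ℕ) : iteratedDeriv n (fun t : ℝ ↦ Complex.exp (-Complex.I * r * t)) =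
      fun t : ℝ ↦ (-Complex.I * r) ^ n * Complex.exp (-Complex.I * r * t) := by
    induction n with
    | zero => simp
    | succ n ih =>
      rw [iteratedDeriv_succ, ih]
      funext t
      have := (((Complex.ofRealCLM.hasDerivAt (x := t)).const_mul (-Complex.I * r)).cexp).const_mul
        ((-Complex.I * r) ^ n)
      simp only [Complex.ofRealCLM_apply] at this
      rw [this.deriv, pow_succ]
      simp only [Complex.ofReal_one]
      ring
  refine ⟨Complex.contDiff_exp.comp (contDiff_const.mul Complex.ofRealCLM.contDiff), fun n ↦
    ⟨0, |r| ^ n, fun t ↦ ?_⟩⟩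
  rw [norm_iteratedFDeriv_eq_norm_iteratedDeriv, hd, norm_mul]
  have : ‖Complex.exp (-Complex.I * r * t)‖ = 1 := by
    simpa [mul_assoc] using norm_exp_neg_I_mul_ofReal (r * t)
  rw [this]
  simp

theorem hasTemperateGrowth_circAe {d : ℕ} (ε : ℝ) {A : Vd d → Vd d}
    (hA : ∀ l, CPol fun x : Vd d => A x l) :
    (fun p : Vd d × Vd d ↦ circAe ε A p.1 p.2).HasTemperateGrowth := by
  have hA' (l : Fin d) : (fun x ↦ A x l).HasTemperateGrowth :=
    ⟨(hA l).1, fun n ↦ let ⟨C, k, h⟩ := (hA l).2 n; ⟨k, C, h⟩⟩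
  have hfst : (fun p : Vd d × Vd d ↦ p.1).HasTemperateGrowth :=
    (ContinuousLinearMap.fst ℝ (Vd d) (Vd d)).hasTemperateGrowth
  have hsnd : (fun p : Vd d × Vd d ↦ p.2).HasTemperateGrowth :=
    (ContinuousLinearMap.snd ℝ (Vd d) (Vd d)).hasTemperateGrowth
  have hseg : (fun q : ℝ × Vd d × Vd d ↦
      ε • q.2.1 + q.1 • (ε • q.2.2 - ε • q.2.1)).HasTemperateGrowth := by
    have h1 : (fun q : ℝ × Vd d × Vd d ↦ q.1).HasTemperateGrowth :=
      (ContinuousLinearMap.fst ℝ ℝ (Vd d × Vd d)).hasTemperateGrowth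
    have h2 : (fun q : ℝ × Vd d × Vd d ↦ q.2).HasTemperateGrowth :=
      (ContinuousLinearMap.snd ℝ ℝ (Vd d × Vd d)).hasTemperateGrowth
    have h3 := (Function.HasTemperateGrowth.const ε).smul (hfst.comp h2)
    have h4 := (Function.HasTemperateGrowth.const ε).smul (hsnd.comp h2)
    exact h3.add (h1.smul (h4.sub h3))
  unfold circAe circA
  refine (Function.HasTemperateGrowth.const ε⁻¹).mul
    (Function.HasTemperateGrowth.sum fun l _ ↦ Function.HasTemperateGrowth.mul ?_
      ((hA' l).comp hseg).intervalIntegral)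
  have hl : (fun x : Vd d ↦ x l).HasTemperateGrowth :=
    (ContinuousLinearMap.proj (R := ℝ) (φ := fun _ : Fin d ↦ ℝ) l).hasTemperateGrowth
  have hε := Function.HasTemperateGrowth.const (E := Vd d × Vd d) ε
  exact (hl.comp (hε.smul hsnd)).sub (hl.comp (hε.smul hfst))

/-- The linear change of variables `(x, y) ↦ (x / ε - y / 2, x / ε + y / 2)`. -/
def wignerEquiv (d : ℕ) {ε : ℝ} (hε : ε ≠ 0) : (Vd d × Vd d) ≃L[ℝ] (Vd d × Vd d) :=
  ContinuousLinearEquiv.equivOfInverse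
    ((ε⁻¹ • ContinuousLinearMap.fst ℝ (Vd d) (Vd d) -
        (2 : ℝ)⁻¹ • ContinuousLinearMap.snd ℝ (Vd d) (Vd d)).prod
      (ε⁻¹ • ContinuousLinearMap.fst ℝ (Vd d) (Vd d) +
        (2 : ℝ)⁻¹ • ContinuousLinearMap.snd ℝ (Vd d) (Vd d)))
    (((ε / 2) • (ContinuousLinearMap.fst ℝ (Vd d) (Vd d) +
        ContinuousLinearMap.snd ℝ (Vd d) (Vd d))).prod
      (ContinuousLinearMap.snd ℝ (Vd d) (Vd d) - ContinuousLinearMap.fst ℝ (Vd d) (Vd d)))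
    (fun p ↦ by ext i <;> simp <;> field_simp <;> ring)
    (fun p ↦ by ext i <;> simp <;> field_simp <;> ring)

/-- The magnetic Wigner transform of two Schwartz functions is a Schwartz function
on phase space `ℝ^{2d}`. -/
theorem statement4 (d : ℕ) (hd : 1 ≤ d) (ε : ℝ) (hε : 0 < ε) (lam : ℝ)
    (A : Vd d → Vd d) (hA : ∀ l, CPol fun x : Vd d => A x l)
    (φ ψ : SchwartzMap (Vd d) ℂ) :
    ∃ F : SchwartzMap (Vd d × Vd d) ℂ,
      ∀ X : Vd d × Vd d, F X = mWig ε lam A (⇑φ) (⇑ψ) X := by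
  have hphase := (hasTemperateGrowth_cexp_neg_I_mul lam).comp (hasTemperateGrowth_circAe ε hA)
  refine ⟨(SchwartzMap.compCLMOfContinuousLinearEquiv ℝ (wignerEquiv d hε.ne')
    (SchwartzMap.smulLeftCLM ℂ
      ((fun t : ℝ ↦ Complex.exp (-Complex.I * lam * t)) ∘
        fun p : Vd d × Vd d ↦ circAe ε A p.1 p.2)
      ((φ.postcompCLM (Complex.conjCLE : ℂ →L[ℝ] ℂ)).tensor ψ))).partialFourierTransform,
    fun X ↦ integral_congr_ae (.of_forall fun y ↦ ?_)⟩
  simp only [SchwartzMap.compCLMOfContinuousLinearEquiv_apply, Function.comp_apply,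
    SchwartzMap.smulLeftCLM_apply_apply hphase]
  simp [SchwartzMap.tensor_apply, wignerEquiv, mul_assoc]
end
end

section
/- Let d ≥ 1, ε > 0, λ ∈ ℝ, and let the components of A : ℝ^d → ℝ^d be of class C^∞_pol. For f, g ∈ S(ℝ^{2d}) define, for X = (x,ξ), the magnetic Weyl product (f ⋆ g)(X) := (2π)^{-2d} ∫_{ℝ^{2d}} ∫_{ℝ^{2d}} e^{iσ(X,Y+Z)} e^{i(ε/2)σ(Y,Z)} Ω^B( x − (ε/2)(y+z), x + (ε/2)(y−z), x + (ε/2)(y+z) ) (F_σ f)(Y) (F_σ g)(Z) dY dZ, where Ω^B(a,b,c) := e^{−i(λ/ε)( Γ^A([a,b]) + Γ^A([b,c]) + Γ^A([c,a]) )}; this integral converges absolutely for every X. Then the product represents operator composition: for all φ, ψ ∈ S(ℝ^d), ∫_{ℝ^d} conj(φ(x)) ( Op^A_{ε,λ}(f)( Op^A_{ε,λ}(g)ψ ) )(x) dx = (2πε)^{-d} ∫_{ℝ^{2d}} (f ⋆ g)(X) W^A_{ε,λ}(φ,ψ)(X) dX. -/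
noncomputable section
open MeasureTheory Complex

/-- The symplectic form `σ((x,ξ),(y,η)) = ξ·y - x·η`. -/
def symp {d : ℕ} (X Y : Vd d × Vd d) : ℝ := dotR X.2 Y.1 - dotR X.1 Y.2

/-- The symplectic Fourier transform `(F_σ f)(Y) = (2π)^{-d} ∫ e^{iσ(Y,X)} f(X) dX`. -/
def symFT {d : ℕ} (f : Vd d × Vd d → ℂ) (Y : Vd d × Vd d) : ℂ :=
  (((2 * Real.pi) ^ d)⁻¹ : ℝ) *
    ∫ X : Vd d × Vd d, Complex.exp (Complex.I * symp Y X) * f X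

/-- Exponential of (λ/ε times) the circulation of `A` around the triangle `⟨a,b,c⟩`,
i.e. by Stokes the magnetic flux of `B = dA` through that triangle. -/
def OmegaB {d : ℕ} (ε lam : ℝ) (A : Vd d → Vd d) (a b c : Vd d) : ℂ :=
  Complex.exp (-Complex.I * (lam / ε) * (circA A a b + circA A b c + circA A c a))

/-- The magnetic Weyl product. -/
def magProd {d : ℕ} (ε lam : ℝ) (A : Vd d → Vd d) (f g : Vd d × Vd d → ℂ)
    (X : Vd d × Vd d) : ℂ :=
  (((2 * Real.pi) ^ (2 * d))⁻¹ : ℝ) * ∫ Y : Vd d × Vd d, ∫ Z : Vd d × Vd d,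
    Complex.exp (Complex.I * symp X (Y + Z)) *
      Complex.exp (Complex.I * (ε / 2) * symp Y Z) *
      OmegaB ε lam A (X.1 - (ε / 2) • (Y.1 + Z.1)) (X.1 + (ε / 2) • (Y.1 - Z.1))
        (X.1 + (ε / 2) • (Y.1 + Z.1)) *
      symFT f Y * symFT g Z

open scoped FourierTransform SchwartzMap
open WithLp (toLp ofLp)

/-- On `L¹ ∩ L²` the Fourier transform on `L²` is given by the Fourier integral. -/
theorem fourier_toLp_ae_eq {E : Type*} [NormedAddCommGroup E] [InnerProductSpace ℝ E]
    [FiniteDimensional ℝ E] [MeasurableSpace E] [BorelSpace E] {f : E → ℂ}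
    (h1 : Integrable f) (h2 : MemLp f 2) :
    ((𝓕 (h2.toLp f) : Lp ℂ 2 (volume : Measure E)) : E → ℂ) =ᵐ[volume] 𝓕 f := by
  have hcont : Continuous (𝓕 f) := by
    exact VectorFourier.fourierIntegral_continuous Real.continuous_fourierChar
      (by exact continuous_inner) h1
  refine ae_eq_of_integral_contDiff_smul_eq ?_ hcont.locallyIntegrable ?_
  · exact (Lp.memLp _).locallyIntegrable (by norm_num)
  intro g hg hgs
  have hgs' : HasCompactSupport (fun x => (g x : ℂ)) := hgs.comp_left (g := Complex.ofReal) rfl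
  have hg' : ContDiff ℝ (⊤ : ℕ∞) (fun x => (g x : ℂ)) := Complex.ofRealCLM.contDiff.comp hg
  let G : 𝓢(E, ℂ) := hgs'.toSchwartzMap hg'
  have hG : ∀ x, G x = g x := fun x => rfl
  have key := congrArg (fun T => T G) (Lp.fourier_toTemperedDistribution_eq (h2.toLp f))
  simp only [TemperedDistribution.fourier_apply, Lp.toTemperedDistribution_apply] at key
  have e1 : ∫ x, g x • (𝓕 (h2.toLp f) : Lp ℂ 2 (volume : Measure E)) x
      = ∫ x, G x • (𝓕 (h2.toLp f) : Lp ℂ 2 (volume : Measure E)) x := by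
    simp [hG]
  rw [e1, ← key]
  have e2 : ∫ x, (𝓕 G) x • (h2.toLp f : E → ℂ) x = ∫ x, (𝓕 G) x • f x := by
    refine integral_congr_ae ?_
    filter_upwards [h2.coeFn_toLp] with x hx
    rw [hx]
  rw [e2, SchwartzMap.fourier_coe]
  have := VectorFourier.integral_fourierIntegral_smul_eq_flip (μ := (volume : Measure E))
    (ν := (volume : Measure E)) (L := innerₗ E) Real.continuous_fourierChar
    (by exact continuous_inner) (G.integrable (μ := volume)) h1
  rw [flip_innerₗ] at this
  refine this.trans ?_
  simp [hG]
  rfl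

theorem fourier_memLp_two {E : Type*} [NormedAddCommGroup E] [InnerProductSpace ℝ E]
    [FiniteDimensional ℝ E] [MeasurableSpace E] [BorelSpace E] {f : E → ℂ}
    (h1 : Integrable f) (h2 : MemLp f 2) : MemLp (𝓕 f) 2 :=
  (memLp_congr_ae (fourier_toLp_ae_eq h1 h2)).1 (Lp.memLp _)

theorem integral_conj_fourier_mul_fourier {E : Type*} [NormedAddCommGroup E]
    [InnerProductSpace ℝ E]
    [FiniteDimensional ℝ E] [MeasurableSpace E] [BorelSpace E] {f g : E → ℂ}
    (hf1 : Integrable f) (hf2 : MemLp f 2) (hg1 : Integrable g) (hg2 : MemLp g 2) :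
    ∫ w, (starRingEnd ℂ) (𝓕 f w) * 𝓕 g w = ∫ v, (starRingEnd ℂ) (f v) * g v := by
  have h := Lp.inner_fourier_eq (hf2.toLp f) (hg2.toLp g)
  rw [L2.inner_def, L2.inner_def] at h
  simp only [RCLike.inner_apply] at h
  refine Eq.trans ?_ (h.trans ?_)
  · refine integral_congr_ae ?_
    filter_upwards [fourier_toLp_ae_eq hf1 hf2, fourier_toLp_ae_eq hg1 hg2] with x h1 h2
    rw [h1, h2, mul_comm]
  · refine integral_congr_ae ?_
    filter_upwards [hf2.coeFn_toLp, hg2.coeFn_toLp] with x h1 h2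
    rw [h1, h2, mul_comm]

theorem dotR_comm {d : ℕ} (x y : Vd d) : dotR x y = dotR y x :=
  Finset.sum_congr rfl fun _ _ => mul_comm _ _

theorem dotR_smul_right {d : ℕ} (c : ℝ) (x y : Vd d) : dotR x (c • y) = c * dotR x y := by
  simp only [dotR, Finset.mul_sum, Pi.smul_apply, smul_eq_mul]
  exact Finset.sum_congr rfl fun _ _ => by ring

theorem dotR_neg_right {d : ℕ} (x y : Vd d) : dotR x (-y) = -dotR x y := by
  simp [dotR]

theorem dotR_add_right {d : ℕ} (x y z : Vd d) : dotR x (y + z) = dotR x y + dotR x z := by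
  simp [dotR, mul_add, Finset.sum_add_distrib]

theorem dotR_sub_right {d : ℕ} (x y z : Vd d) : dotR x (y - z) = dotR x y - dotR x z := by
  simp [dotR, mul_sub]

theorem continuous_dotR {d : ℕ} : Continuous fun p : Vd d × Vd d => dotR p.1 p.2 := by
  unfold dotR
  fun_prop

theorem inner_toLp {d : ℕ} (x : EuclideanSpace ℝ (Fin d)) (v : Vd d) :
    inner ℝ x (toLp 2 v) = dotR (ofLp x) v := by
  simp only [PiLp.inner_apply, dotR, RCLike.inner_apply, conj_trivial]
  exact Finset.sum_congr rfl fun _ _ => mul_comm _ _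

/-- The Fourier transform on `ℝ^d` in the convention without `2π` in the exponent. -/
def fourierVd {d : ℕ} (F : Vd d → ℂ) (ξ : Vd d) : ℂ :=
  ∫ u : Vd d, Complex.exp (-Complex.I * dotR u ξ) * F u

theorem fourierVd_eq {d : ℕ} (F : Vd d → ℂ) (ξ : Vd d) :
    fourierVd F ξ = 𝓕 (fun x : EuclideanSpace ℝ (Fin d) => F (ofLp x))
      (toLp 2 ((2 * Real.pi)⁻¹ • ξ)) := by
  rw [Real.fourier_eq', fourierVd,
    ← (PiLp.volume_preserving_ofLp (Fin d)).integral_comp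
      (MeasurableEquiv.toLp 2 (Fin d → ℝ)).symm.measurableEmbedding]
  refine integral_congr_ae (Filter.Eventually.of_forall fun x => ?_)
  simp only [smul_eq_mul]
  congr 2
  rw [inner_toLp, dotR_smul_right]
  have hpi : (Real.pi : ℂ) ≠ 0 := by exact_mod_cast Real.pi_ne_zero
  push_cast
  field_simp

theorem integral_toLp_smul {d : ℕ} (h : EuclideanSpace ℝ (Fin d) → ℂ) :
    ∫ ξ : Vd d, h (toLp 2 ((2 * Real.pi)⁻¹ • ξ)) = ((2 * Real.pi) ^ d : ℝ) * ∫ x, h x := by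
  rw [Measure.integral_comp_inv_smul volume (fun ξ : Vd d => h (toLp 2 ξ)),
    (PiLp.volume_preserving_toLp (Fin d)).integral_comp
      (MeasurableEquiv.toLp 2 (Fin d → ℝ)).measurableEmbedding]
  have : (0:ℝ) ≤ 2 * Real.pi := by positivity
  rw [Module.finrank_fin_fun, abs_of_nonneg (by positivity)]
  exact Complex.real_smul

theorem integrable_toLp_smul_iff {d : ℕ} (h : EuclideanSpace ℝ (Fin d) → ℂ) :
    Integrable (fun ξ : Vd d => h (toLp 2 ((2 * Real.pi)⁻¹ • ξ))) ↔ Integrable h := by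
  have h2 : (2 * Real.pi)⁻¹ ≠ 0 := by positivity
  rw [integrable_comp_smul_iff volume (fun ξ : Vd d => h (toLp 2 ξ)) h2]
  exact (PiLp.volume_preserving_toLp (Fin d)).integrable_comp_emb
      (MeasurableEquiv.toLp 2 (Fin d → ℝ)).measurableEmbedding

theorem integrable_comp_ofLp {d : ℕ} {F : Vd d → ℂ} (hF : Integrable F) :
    Integrable (fun x : EuclideanSpace ℝ (Fin d) => F (ofLp x)) :=
  ((PiLp.volume_preserving_ofLp (Fin d)).integrable_comp_emb
      (MeasurableEquiv.toLp 2 (Fin d → ℝ)).symm.measurableEmbedding).2 hF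

theorem memLp_comp_ofLp {d : ℕ} {F : Vd d → ℂ} (hF : MemLp F 2) :
    MemLp (fun x : EuclideanSpace ℝ (Fin d) => F (ofLp x)) 2 :=
  hF.comp_measurePreserving (PiLp.volume_preserving_ofLp (Fin d))

/-- Parseval's identity on `ℝ^d`. -/
theorem integral_conj_fourierVd_mul_fourierVd {d : ℕ} {a b : Vd d → ℂ}
    (ha1 : Integrable a) (ha2 : MemLp a 2) (hb1 : Integrable b) (hb2 : MemLp b 2) :
    Integrable (fun ξ => (starRingEnd ℂ) (fourierVd a ξ) * fourierVd b ξ) ∧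
    ∫ ξ, (starRingEnd ℂ) (fourierVd a ξ) * fourierVd b ξ
      = ((2 * Real.pi) ^ d : ℝ) * ∫ u, (starRingEnd ℂ) (a u) * b u := by
  have ha1' := integrable_comp_ofLp ha1
  have hb1' := integrable_comp_ofLp hb1
  have ha2' := memLp_comp_ofLp ha2
  have hb2' := memLp_comp_ofLp hb2
  simp only [fourierVd_eq]
  refine ⟨(integrable_toLp_smul_iff (fun x => (starRingEnd ℂ)
    (𝓕 (fun x : EuclideanSpace ℝ (Fin d) => a (ofLp x)) x) *
      𝓕 (fun x : EuclideanSpace ℝ (Fin d) => b (ofLp x)) x)).2 ?_, ?_⟩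
  · exact (fourier_memLp_two ha1' ha2').star.integrable_mul (fourier_memLp_two hb1' hb2')
  · rw [integral_toLp_smul (fun x => (starRingEnd ℂ)
      (𝓕 (fun x : EuclideanSpace ℝ (Fin d) => a (ofLp x)) x) *
      𝓕 (fun x : EuclideanSpace ℝ (Fin d) => b (ofLp x)) x),
      integral_conj_fourier_mul_fourier ha1' ha2' hb1' hb2']
    congr 1
    exact (PiLp.volume_preserving_ofLp (Fin d)).integral_comp
      (MeasurableEquiv.toLp 2 (Fin d → ℝ)).symm.measurableEmbedding
      (fun u => (starRingEnd ℂ) (a u) * b u)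

/-- Fourier inversion on `ℝ^d`. -/
theorem fourierVd_inversion {d : ℕ} {F : Vd d → ℂ} (hc : Continuous F) (hF : Integrable F)
    (hF' : Integrable (fourierVd F)) (p : Vd d) :
    ∫ η, Complex.exp (Complex.I * dotR p η) * fourierVd F η
      = ((2 * Real.pi) ^ d : ℝ) * F p := by
  set G := fun x : EuclideanSpace ℝ (Fin d) => F (ofLp x) with hG
  have hG1 : Integrable G := integrable_comp_ofLp hF
  have hGc : Continuous G := hc.comp (PiLp.continuous_ofLp 2 _)
  have hG2 : Integrable (𝓕 G) := by
    rw [← integrable_toLp_smul_iff]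
    exact hF'.congr (Filter.Eventually.of_forall (fourierVd_eq F))
  have h := congrFun (hGc.fourierInv_fourier_eq hG1 hG2) (toLp 2 p)
  rw [Real.fourierInv_eq'] at h
  have h' : F p = G (toLp 2 p) := rfl
  rw [h', ← h, ← integral_toLp_smul]
  refine integral_congr_ae (Filter.Eventually.of_forall fun x => ?_)
  simp only [smul_eq_mul]
  congr 2
  · rw [inner_toLp, WithLp.ofLp_toLp, dotR_comm (_ • x), dotR_smul_right]
    have hpi : (Real.pi : ℂ) ≠ 0 := by exact_mod_cast Real.pi_ne_zero
    push_cast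
    field_simp
  · exact fourierVd_eq F x

/-- The symplectic Fourier transform of a Schwartz function is a Schwartz function. -/
theorem exists_schwartzMap_symFT {d : ℕ} (f : 𝓢(Vd d × Vd d, ℂ)) :
    ∃ S : 𝓢(Vd d × Vd d, ℂ), ∀ Y, symFT (⇑f) Y = S Y := by
  let e0 : EuclideanSpace ℝ (Fin d) ≃L[ℝ] Vd d :=
    PiLp.continuousLinearEquiv 2 ℝ (fun _ : Fin d => ℝ)
  let e : WithLp 2 (EuclideanSpace ℝ (Fin d) × EuclideanSpace ℝ (Fin d)) ≃L[ℝ] (Vd d × Vd d) :=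
    (WithLp.prodContinuousLinearEquiv 2 ℝ _ _).trans (e0.prodCongr e0)
  let sw : (Vd d × Vd d) ≃L[ℝ] (Vd d × Vd d) :=
    (ContinuousLinearEquiv.prodComm ℝ (Vd d) (Vd d)).trans
      ((ContinuousLinearEquiv.neg ℝ).prodCongr (ContinuousLinearEquiv.refl ℝ (Vd d)))
  let L : (Vd d × Vd d) ≃L[ℝ] WithLp 2 (EuclideanSpace ℝ (Fin d) × EuclideanSpace ℝ (Fin d)) :=
    (sw.trans (ContinuousLinearEquiv.smulLeft
      (Units.mk0 (2 * Real.pi)⁻¹ (by positivity)))).trans e.symm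
  have hL : ∀ Y, L Y = toLp 2 (toLp 2 ((2 * Real.pi)⁻¹ • (-Y.2)),
    toLp 2 ((2 * Real.pi)⁻¹ • Y.1)) := fun Y => rfl
  let G : 𝓢(WithLp 2 (EuclideanSpace ℝ (Fin d) × EuclideanSpace ℝ (Fin d)), ℂ) :=
    SchwartzMap.compCLMOfContinuousLinearEquiv ℂ e f
  have he : MeasurePreserving e := by
    have h1 := WithLp.volume_preserving_ofLp (EuclideanSpace ℝ (Fin d)) (EuclideanSpace ℝ (Fin d))
    have h2 := (PiLp.volume_preserving_ofLp (Fin d)).prod (PiLp.volume_preserving_ofLp (Fin d))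
    exact h2.comp h1
  refine ⟨(((2 * Real.pi) ^ d)⁻¹ : ℝ) •
    SchwartzMap.compCLMOfContinuousLinearEquiv ℂ L (𝓕 G), fun Y => ?_⟩
  rw [smul_apply, Complex.real_smul, symFT]
  congr 1
  rw [SchwartzMap.compCLMOfContinuousLinearEquiv_apply, Function.comp_apply,
    SchwartzMap.fourier_coe, Real.fourier_eq', hL,
    ← he.integral_comp e.toHomeomorph.measurableEmbedding]
  refine integral_congr_ae (Filter.Eventually.of_forall fun x => ?_)
  simp only [smul_eq_mul]
  have hG : G x = f (e x) := rfl
  rw [hG]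
  congr 2
  have hx : e x = (ofLp (ofLp x).1, ofLp (ofLp x).2) := rfl
  have : inner ℝ x (toLp 2 (toLp 2 ((2 * Real.pi)⁻¹ • (-Y.2)), toLp 2 ((2 * Real.pi)⁻¹ • Y.1)))
      = - ((2 * Real.pi)⁻¹ * symp Y (e x)) := by
    rw [WithLp.prod_inner_apply, hx, symp]
    dsimp only
    rw [inner_toLp, inner_toLp, dotR_smul_right, dotR_smul_right, dotR_neg_right,
      dotR_comm Y.1, dotR_comm Y.2]
    ring
  rw [this]
  have hpi : (Real.pi : ℂ) ≠ 0 := by exact_mod_cast Real.pi_ne_zero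
  push_cast
  field_simp

/-- The integrable weight `(1 + |v|)^{-(d+1)}`. -/
def wt {d : ℕ} (v : Vd d) : ℝ := ((1 + ‖v‖) ^ (d + 1))⁻¹

theorem wt_pos {d : ℕ} (v : Vd d) : 0 < wt v := by
  unfold wt; positivity

theorem wt_le_one {d : ℕ} (v : Vd d) : wt v ≤ 1 :=
  inv_le_one_of_one_le₀ (one_le_pow₀ (by linarith [norm_nonneg v]))

theorem wt_sq_le {d : ℕ} (v : Vd d) : wt v ^ 2 ≤ wt v :=
  pow_le_of_le_one (wt_pos _).le (wt_le_one _) two_ne_zero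

theorem continuous_wt {d : ℕ} : Continuous (wt : Vd d → ℝ) := by
  unfold wt
  exact Continuous.inv₀ (by fun_prop) fun v => by positivity

theorem integrable_wt {d : ℕ} : Integrable (wt : Vd d → ℝ) := by
  have h := integrable_one_add_norm (E := Vd d) (μ := volume) (r := (d + 1 : ℕ))
    (by simp)
  refine h.congr (Filter.Eventually.of_forall fun v => ?_)
  simp only [wt]
  rw [Real.rpow_neg (by positivity), Real.rpow_natCast]

theorem wt_mul_wt_le {d : ℕ} {a c v : Vd d} (h : ‖v‖ ≤ ‖a‖ + ‖c‖) : wt a * wt c ≤ wt v := by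
  unfold wt
  rw [← mul_inv, ← mul_pow]
  have := mul_nonneg (norm_nonneg a) (norm_nonneg c)
  gcongr
  nlinarith

theorem SchwartzMap.exists_decay {E : Type*} [NormedAddCommGroup E] [NormedSpace ℝ E]
    (φ : 𝓢(E, ℂ)) (k : ℕ) : ∃ C, 0 ≤ C ∧ ∀ v, ‖φ v‖ ≤ C * ((1 + ‖v‖) ^ k)⁻¹ := by
  refine ⟨2 ^ k * ((Finset.Iic (k, 0)).sup fun m => SchwartzMap.seminorm ℝ m.1 m.2) φ,
    by positivity, fun v => ?_⟩
  have := SchwartzMap.one_add_le_sup_seminorm_apply (𝕜 := ℝ) (m := (k, 0)) (k := k) (n := 0)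
    le_rfl le_rfl φ v
  rw [norm_iteratedFDeriv_zero] at this
  rw [← div_eq_mul_inv, le_div_iff₀ (by positivity), mul_comm]
  exact this

theorem SchwartzMap.exists_wt_decay {d : ℕ} (φ : 𝓢(Vd d, ℂ)) :
    ∃ C, 0 ≤ C ∧ ∀ v, ‖φ v‖ ≤ C * wt v ^ 2 := by
  obtain ⟨C, hC, h⟩ := φ.exists_decay ((d + 1) * 2)
  refine ⟨C, hC, fun v => (h v).trans_eq ?_⟩
  rw [wt, inv_pow, ← pow_mul]

theorem SchwartzMap.exists_wt_decay_prod {d : ℕ} (φ : 𝓢(Vd d × Vd d, ℂ)) :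
    ∃ C, 0 ≤ C ∧ ∀ x y, ‖φ (x, y)‖ ≤ C * (wt x ^ 2 * wt y) := by
  obtain ⟨C, hC, h⟩ := φ.exists_decay ((d + 1) * 2 + (d + 1))
  refine ⟨C, hC, fun x y => (h _).trans (mul_le_mul_of_nonneg_left ?_ hC)⟩
  rw [wt, wt, inv_pow, ← pow_mul, ← mul_inv, pow_add]
  have h1 : ‖x‖ ≤ ‖(x, y)‖ := le_max_left _ _
  have h2 : ‖y‖ ≤ ‖(x, y)‖ := le_max_right _ _
  gcongr

theorem SchwartzMap.integrable_prod {d : ℕ} (φ : 𝓢(Vd d × Vd d, ℂ)) :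
    Integrable (⇑φ) (volume.prod volume) := by
  obtain ⟨C, hC, h⟩ := φ.exists_wt_decay_prod
  refine ((integrable_wt.mul_prod integrable_wt).const_mul C).mono'
    φ.continuous.aestronglyMeasurable (Filter.Eventually.of_forall fun X => (h X.1 X.2).trans ?_)
  refine mul_le_mul_of_nonneg_left (mul_le_mul_of_nonneg_right ?_ (wt_pos _).le) hC
  exact wt_sq_le _

theorem norm_cexp_eq_one {z : ℂ} (hz : z.re = 0) : ‖Complex.exp z‖ = 1 := by
  rw [Complex.norm_exp, hz, Real.exp_zero]

theorem continuous_dotR_comp {d : ℕ} {X : Type*} [TopologicalSpace X] {u v : X → Vd d}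
    (hu : Continuous u) (hv : Continuous v) : Continuous fun x => dotR (u x) (v x) :=
  continuous_dotR.comp (hu.prodMk hv)

theorem continuous_circA {d : ℕ} {A : Vd d → Vd d} (hA : Continuous A) :
    Continuous fun p : Vd d × Vd d => circA A p.1 p.2 := by
  unfold circA
  refine continuous_finsetSum _ fun l _ => Continuous.mul (by fun_prop) ?_
  refine intervalIntegral.continuous_parametric_intervalIntegral_of_continuous' ?_ 0 1
  simp only [Function.uncurry_def]
  fun_prop

theorem circA_swap {d : ℕ} (A : Vd d → Vd d) (u v : Vd d) : circA A v u = -circA A u v := by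
  unfold circA
  rw [← Finset.sum_neg_distrib]
  refine Finset.sum_congr rfl fun l _ => ?_
  have := intervalIntegral.integral_comp_sub_left (a := 0) (b := 1)
    (fun s : ℝ => A (u + s • (v - u)) l) 1
  rw [sub_self, sub_zero] at this
  rw [← this, ← neg_mul, neg_sub]
  congr 2
  ext s
  refine congrArg (fun w => A w l) ?_
  module

/-- The partial Fourier transform in the second variable. -/
def partialFT {d : ℕ} (f : Vd d × Vd d → ℂ) (p y : Vd d) : ℂ :=
  (((2 * Real.pi) ^ d)⁻¹ : ℝ) * fourierVd (fun η => f (p, η)) y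

theorem continuous_fourierVd_section {d : ℕ} (f : 𝓢(Vd d × Vd d, ℂ)) :
    Continuous fun q : Vd d × Vd d => fourierVd (fun η => f (q.1, η)) q.2 := by
  obtain ⟨C, hC, h⟩ := f.exists_wt_decay_prod
  unfold fourierVd
  refine continuous_of_dominated (bound := fun η => C * wt η) (fun q => ?_) (fun q => ?_)
    (integrable_wt.const_mul C) (Filter.Eventually.of_forall fun η => ?_)
  · have : Continuous fun u => dotR u q.2 := continuous_dotR_comp continuous_id continuous_const
    exact Continuous.aestronglyMeasurable (by fun_prop)
  · refine Filter.Eventually.of_forall fun η => ?_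
    rw [norm_mul, norm_cexp_eq_one (by simp), one_mul]
    refine (h _ _).trans (mul_le_mul_of_nonneg_left ?_ hC)
    exact mul_le_of_le_one_left (wt_pos _).le (pow_le_one₀ (wt_pos _).le (wt_le_one _))
  · have : Continuous fun x : Vd d × Vd d => dotR η x.2 :=
      continuous_dotR_comp continuous_const continuous_snd
    fun_prop

theorem continuous_partialFT {d : ℕ} (f : 𝓢(Vd d × Vd d, ℂ)) :
    Continuous fun q : Vd d × Vd d => partialFT f q.1 q.2 :=
  continuous_const.mul (continuous_fourierVd_section f)

theorem fourierVd_fourierVd_section {d : ℕ} (f : 𝓢(Vd d × Vd d, ℂ)) (y η : Vd d) :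
    fourierVd (fun x => fourierVd (fun ξ => f (x, ξ)) y) η
      = ((2 * Real.pi) ^ d : ℝ) * symFT f (y, -η) := by
  have h2 : ((2 * Real.pi) ^ d : ℝ) ≠ 0 := by positivity
  rw [symFT, ← mul_assoc, ← Complex.ofReal_mul, mul_inv_cancel₀ h2, Complex.ofReal_one, one_mul,
    Measure.volume_eq_prod, integral_prod]
  · simp only [fourierVd, ← integral_const_mul]
    refine integral_congr_ae (Filter.Eventually.of_forall fun x => ?_)
    refine integral_congr_ae (Filter.Eventually.of_forall fun ξ => ?_)
    simp only [symp]
    rw [← mul_assoc, ← Complex.exp_add, dotR_comm (-η), dotR_neg_right, dotR_comm y]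
    congr 2
    push_cast
    ring
  · have h0 : Integrable (⇑f) (volume.prod volume) := f.integrable_prod
    have hc : Continuous fun X : Vd d × Vd d => symp (y, -η) X :=
      (continuous_dotR_comp continuous_const continuous_fst).sub
        (continuous_dotR_comp continuous_const continuous_snd)
    refine h0.bdd_mul (c := 1) (Continuous.aestronglyMeasurable (by fun_prop))
      (Filter.Eventually.of_forall fun X => (norm_cexp_eq_one (by simp)).le)

theorem integrable_symFT_section {d : ℕ} (f : 𝓢(Vd d × Vd d, ℂ)) (y : Vd d) :
    Integrable fun η => symFT f (y, η) := by
  obtain ⟨S, hS⟩ := exists_schwartzMap_symFT f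
  obtain ⟨C, hC, h⟩ := S.exists_wt_decay_prod
  simp only [hS]
  refine (integrable_wt.const_mul (C * wt y ^ 2)).mono'
    (Continuous.aestronglyMeasurable (by fun_prop)) (Filter.Eventually.of_forall fun η => ?_)
  rw [mul_assoc]
  exact h _ _

theorem integral_exp_mul_symFT {d : ℕ} (f : 𝓢(Vd d × Vd d, ℂ)) (p y : Vd d) :
    ∫ η, Complex.exp (-Complex.I * dotR p η) * symFT f (y, η)
      = ((2 * Real.pi) ^ d : ℝ) * partialFT f p y := by
  have h2 : (((2 * Real.pi) ^ d : ℝ) : ℂ) ≠ 0 := by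
    exact_mod_cast (by positivity : ((2 * Real.pi) ^ d : ℝ) ≠ 0)
  have h0 : Integrable (⇑f) (volume.prod volume) := f.integrable_prod
  have hc : Continuous fun X : Vd d × Vd d => dotR X.2 y :=
    continuous_dotR_comp continuous_snd continuous_const
  have h1 : Integrable (fun X : Vd d × Vd d => Complex.exp (-Complex.I * dotR X.2 y) * f X)
      (volume.prod volume) :=
    h0.bdd_mul (c := 1) (Continuous.aestronglyMeasurable (by fun_prop))
      (Filter.Eventually.of_forall fun X => (norm_cexp_eq_one (by simp)).le)
  have hF' : Integrable (fourierVd fun x => fourierVd (fun ξ => f (x, ξ)) y) := by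
    rw [show (fourierVd fun x => fourierVd (fun ξ => f (x, ξ)) y) = _ from
      funext fun η => fourierVd_fourierVd_section f y η]
    exact (integrable_symFT_section f y).comp_neg.const_mul _
  have hcont : Continuous fun x => fourierVd (fun ξ => f (x, ξ)) y :=
    (continuous_fourierVd_section f).comp (continuous_id.prodMk continuous_const)
  have key := fourierVd_inversion hcont h1.integral_prod_left hF' p
  simp only [fourierVd_fourierVd_section] at key
  rw [partialFT, Complex.ofReal_inv, mul_inv_cancel_left₀ h2]
  refine mul_left_cancel₀ h2 (Eq.trans ?_ key)
  rw [← integral_const_mul, ← integral_neg_eq_self]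
  refine integral_congr_ae (Filter.Eventually.of_forall fun η => ?_)
  simp only [dotR_neg_right, Complex.ofReal_neg, neg_mul_neg]
  ring

theorem exists_partialFT_decay {d : ℕ} (f : 𝓢(Vd d × Vd d, ℂ)) :
    ∃ C, 0 ≤ C ∧ ∀ p y, ‖partialFT f p y‖ ≤ C * wt y ^ 2 := by
  obtain ⟨S, hS⟩ := exists_schwartzMap_symFT f
  obtain ⟨C, hC, h⟩ := S.exists_wt_decay_prod
  have h2 : ((2 * Real.pi) ^ d : ℝ) ≠ 0 := by positivity
  refine ⟨((2 * Real.pi) ^ d)⁻¹ * (C * ∫ η : Vd d, wt η),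
    mul_nonneg (by positivity) (mul_nonneg hC (integral_nonneg fun η => (wt_pos η).le)),
    fun p y => ?_⟩
  have e : partialFT f p y = (((2 * Real.pi) ^ d)⁻¹ : ℝ) *
      ∫ η, Complex.exp (-Complex.I * dotR p η) * symFT f (y, η) := by
    rw [integral_exp_mul_symFT, ← mul_assoc, ← Complex.ofReal_mul, inv_mul_cancel₀ h2,
      Complex.ofReal_one, one_mul]
  rw [e, norm_mul, Complex.norm_real, Real.norm_of_nonneg (by positivity), mul_assoc]
  refine mul_le_mul_of_nonneg_left ?_ (by positivity)
  calc _ ≤ ∫ η, (C * wt y ^ 2) * wt η := by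
        refine norm_integral_le_of_norm_le (integrable_wt.const_mul _)
          (Filter.Eventually.of_forall fun η => ?_)
        rw [norm_mul, norm_cexp_eq_one (by simp), one_mul, hS, mul_assoc]
        exact h _ _
    _ = _ := by rw [integral_const_mul]; ring

/-- The integrand of the magnetic Weyl product. -/
def magIntegrand {d : ℕ} (ε lam : ℝ) (A : Vd d → Vd d) (f g : Vd d × Vd d → ℂ)
    (X Y Z : Vd d × Vd d) : ℂ :=
  Complex.exp (Complex.I * symp X (Y + Z)) *
      Complex.exp (Complex.I * (ε / 2) * symp Y Z) *
      OmegaB ε lam A (X.1 - (ε / 2) • (Y.1 + Z.1)) (X.1 + (ε / 2) • (Y.1 - Z.1))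
        (X.1 + (ε / 2) • (Y.1 + Z.1)) *
      symFT f Y * symFT g Z

theorem continuous_symp_comp {d : ℕ} {T : Type*} [TopologicalSpace T] {u v : T → Vd d × Vd d}
    (hu : Continuous u) (hv : Continuous v) : Continuous fun t => symp (u t) (v t) :=
  (continuous_dotR_comp hu.snd hv.fst).sub (continuous_dotR_comp hu.fst hv.snd)

theorem norm_OmegaB {d : ℕ} (ε lam : ℝ) (A : Vd d → Vd d) (a b c : Vd d) :
    ‖OmegaB ε lam A a b c‖ = 1 := by
  refine norm_cexp_eq_one ?_
  rw [← Complex.ofReal_div, ← Complex.ofReal_add, ← Complex.ofReal_add]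
  simp

theorem continuous_OmegaB_comp {d : ℕ} {ε lam : ℝ} {A : Vd d → Vd d} (hA : Continuous A)
    {T : Type*} [TopologicalSpace T] {a b c : T → Vd d}
    (ha : Continuous a) (hb : Continuous b) (hc : Continuous c) :
    Continuous fun t => OmegaB ε lam A (a t) (b t) (c t) := by
  have h1 : Continuous fun t => circA A (a t) (b t) := (continuous_circA hA).comp (ha.prodMk hb)
  have h2 : Continuous fun t => circA A (b t) (c t) := (continuous_circA hA).comp (hb.prodMk hc)
  have h3 : Continuous fun t => circA A (c t) (a t) := (continuous_circA hA).comp (hc.prodMk ha)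
  unfold OmegaB
  fun_prop

theorem continuous_symFT {d : ℕ} (f : 𝓢(Vd d × Vd d, ℂ)) : Continuous (symFT f) := by
  obtain ⟨S, hS⟩ := exists_schwartzMap_symFT f
  rw [show symFT f = S from funext hS]
  exact S.continuous

theorem integrable_symFT {d : ℕ} (f : 𝓢(Vd d × Vd d, ℂ)) :
    Integrable (symFT f) (volume.prod volume) := by
  obtain ⟨S, hS⟩ := exists_schwartzMap_symFT f
  rw [show symFT f = S from funext hS]
  exact S.integrable_prod

theorem continuous_magIntegrand {d : ℕ} {ε lam : ℝ} {A : Vd d → Vd d} (hA : Continuous A)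
    (f g : 𝓢(Vd d × Vd d, ℂ)) (X : Vd d × Vd d) :
    Continuous fun YZ : (Vd d × Vd d) × (Vd d × Vd d) =>
      magIntegrand ε lam A f g X YZ.1 YZ.2 := by
  have h1 : Continuous fun YZ : (Vd d × Vd d) × (Vd d × Vd d) => symp X (YZ.1 + YZ.2) :=
    continuous_symp_comp continuous_const (by fun_prop)
  have h2 : Continuous fun YZ : (Vd d × Vd d) × (Vd d × Vd d) => symp YZ.1 YZ.2 :=
    continuous_symp_comp continuous_fst continuous_snd
  have h3 : Continuous fun YZ : (Vd d × Vd d) × (Vd d × Vd d) =>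
      OmegaB ε lam A (X.1 - (ε / 2) • (YZ.1.1 + YZ.2.1)) (X.1 + (ε / 2) • (YZ.1.1 - YZ.2.1))
        (X.1 + (ε / 2) • (YZ.1.1 + YZ.2.1)) :=
    continuous_OmegaB_comp hA (by fun_prop) (by fun_prop) (by fun_prop)
  have h4 := continuous_symFT f
  have h5 := continuous_symFT g
  unfold magIntegrand
  fun_prop

theorem norm_magIntegrand {d : ℕ} {ε lam : ℝ} {A : Vd d → Vd d}
    (f g : Vd d × Vd d → ℂ) (X Y Z : Vd d × Vd d) :
    ‖magIntegrand ε lam A f g X Y Z‖ = ‖symFT f Y‖ * ‖symFT g Z‖ := by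
  have h2 : (Complex.I * (ε / 2) * symp Y Z).re = 0 := by
    rw [← Complex.ofReal_ofNat, ← Complex.ofReal_div]
    simp
  simp only [magIntegrand, norm_mul, norm_OmegaB, norm_cexp_eq_one h2]
  rw [norm_cexp_eq_one (by simp)]
  ring

theorem integrable_magIntegrand {d : ℕ} {ε lam : ℝ} {A : Vd d → Vd d} (hA : Continuous A)
    (f g : 𝓢(Vd d × Vd d, ℂ)) (X : Vd d × Vd d) :
    Integrable (fun YZ : (Vd d × Vd d) × (Vd d × Vd d) =>
      magIntegrand ε lam A f g X YZ.1 YZ.2) ((volume.prod volume).prod (volume.prod volume)) := by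
  refine ((integrable_symFT f).norm.mul_prod (integrable_symFT g).norm).mono'
    (continuous_magIntegrand hA f g X).aestronglyMeasurable
    (Filter.Eventually.of_forall fun YZ => ?_)
  rw [norm_magIntegrand]

/-- The kernel of the magnetic Weyl product after integrating out the momentum variables. -/
def magKernel {d : ℕ} (ε lam : ℝ) (A : Vd d → Vd d) (f g : Vd d × Vd d → ℂ)
    (x y z : Vd d) : ℂ :=
  OmegaB ε lam A (x - (ε / 2) • (y + z)) (x + (ε / 2) • (y - z)) (x + (ε / 2) • (y + z)) *
    partialFT f (x - (ε / 2) • z) y * partialFT g (x + (ε / 2) • y) z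

theorem magIntegrand_eq {d : ℕ} (ε lam : ℝ) (A : Vd d → Vd d) (f g : Vd d × Vd d → ℂ)
    (x ξ y η z ζ : Vd d) :
    magIntegrand ε lam A f g (x, ξ) (y, η) (z, ζ) =
      (Complex.exp (Complex.I * dotR ξ (y + z)) *
        OmegaB ε lam A (x - (ε / 2) • (y + z)) (x + (ε / 2) • (y - z)) (x + (ε / 2) • (y + z)) *
        (Complex.exp (-Complex.I * dotR (x - (ε / 2) • z) η) * symFT f (y, η))) *
        (Complex.exp (-Complex.I * dotR (x + (ε / 2) • y) ζ) * symFT g (z, ζ)) := by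
  simp only [magIntegrand]
  have key : Complex.exp (Complex.I * symp (x, ξ) ((y, η) + (z, ζ))) *
      Complex.exp (Complex.I * (ε / 2) * symp (y, η) (z, ζ)) =
      Complex.exp (Complex.I * dotR ξ (y + z)) *
      Complex.exp (-Complex.I * dotR (x - (ε / 2) • z) η) *
      Complex.exp (-Complex.I * dotR (x + (ε / 2) • y) ζ) := by
    rw [← Complex.exp_add, ← Complex.exp_add, ← Complex.exp_add]
    congr 1
    simp only [symp, Prod.mk_add_mk, dotR_comm _ η, dotR_comm _ ζ, dotR_comm _ (η + ζ),
      dotR_add_right, dotR_sub_right, dotR_smul_right]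
    rw [dotR_comm _ x, dotR_comm ζ y, dotR_add_right, dotR_comm x η, dotR_comm x ζ, dotR_comm y ζ]
    push_cast
    ring
  rw [key]
  ring

theorem magProd_eq {d : ℕ} {ε lam : ℝ} {A : Vd d → Vd d} (hA : Continuous A)
    (f g : 𝓢(Vd d × Vd d, ℂ)) (x ξ : Vd d) :
    magProd ε lam A f g (x, ξ) = ∫ y, ∫ z,
      Complex.exp (Complex.I * dotR ξ (y + z)) * magKernel ε lam A f g x y z := by
  obtain ⟨C, hC, hg⟩ := exists_partialFT_decay g
  set P : Vd d → Vd d → ℂ := fun y z => Complex.exp (Complex.I * dotR ξ (y + z)) *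
        OmegaB ε lam A (x - (ε / 2) • (y + z)) (x + (ε / 2) • (y - z)) (x + (ε / 2) • (y + z))
    with hP
  have hPn : ∀ y z, ‖P y z‖ = 1 := fun y z => by
    rw [hP, norm_mul, norm_OmegaB, norm_cexp_eq_one (by simp), one_mul]
  set e : Vd d → Vd d → Vd d → ℂ := fun y η z =>
    Complex.exp (-Complex.I * dotR (x - (ε / 2) • z) η) * symFT f (y, η) with he
  have hint := integrable_magIntegrand (ε := ε) (lam := lam) hA f g (x, ξ)
  have hsec : ∀ Y, Integrable (fun Z => magIntegrand ε lam A f g (x, ξ) Y Z)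
      (volume.prod volume) := fun Y => by
    refine ((integrable_symFT g).norm.const_mul ‖symFT f Y‖).mono' ?_
      (Filter.Eventually.of_forall fun Z => ?_)
    · exact ((continuous_magIntegrand hA f g (x, ξ)).comp
        (continuous_const.prodMk continuous_id)).aestronglyMeasurable
    · rw [norm_magIntegrand]
  have step1 : ∀ Y : Vd d × Vd d, ∫ Z, magIntegrand ε lam A f g (x, ξ) Y Z =
      ∫ z, P Y.1 z * e Y.1 Y.2 z * (((2 * Real.pi) ^ d : ℝ) *
        partialFT g (x + (ε / 2) • Y.1) z) := by
    rintro ⟨y, η⟩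
    rw [Measure.volume_eq_prod, integral_prod _ (hsec _)]
    simp only [magIntegrand_eq, integral_const_mul, integral_exp_mul_symFT]
    rfl
  have hint2 : Integrable (fun Y : Vd d × Vd d =>
      ∫ z, P Y.1 z * e Y.1 Y.2 z * (((2 * Real.pi) ^ d : ℝ) *
        partialFT g (x + (ε / 2) • Y.1) z)) (volume.prod volume) := by
    simp only [← step1]
    exact hint.integral_prod_left
  have step3 : ∀ y, ∫ η, ∫ z, P y z * e y η z * (((2 * Real.pi) ^ d : ℝ) *
        partialFT g (x + (ε / 2) • y) z) = ∫ z, ∫ η, P y z * e y η z * (((2 * Real.pi) ^ d : ℝ) *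
        partialFT g (x + (ε / 2) • y) z) := by
    intro y
    refine integral_integral_swap ?_
    refine ((integrable_symFT_section f y).norm.mul_prod
      (integrable_wt.const_mul ((2 * Real.pi) ^ d * C))).mono' ?_
      (Filter.Eventually.of_forall fun q => ?_)
    · have h1 : Continuous fun q : Vd d × Vd d => dotR ξ (y + q.2) :=
        continuous_dotR_comp continuous_const (by fun_prop)
      have h2 : Continuous fun q : Vd d × Vd d => OmegaB ε lam A (x - (ε / 2) • (y + q.2))
          (x + (ε / 2) • (y - q.2)) (x + (ε / 2) • (y + q.2)) :=
        continuous_OmegaB_comp hA (by fun_prop) (by fun_prop) (by fun_prop)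
      have h3 : Continuous fun q : Vd d × Vd d => dotR (x - (ε / 2) • q.2) q.1 :=
        continuous_dotR_comp (by fun_prop) (by fun_prop)
      have h4 := continuous_symFT f
      have h5 : Continuous fun q : Vd d × Vd d => partialFT g (x + (ε / 2) • y) q.2 :=
        (continuous_partialFT g).comp (continuous_const.prodMk continuous_snd)
      simp only [Function.uncurry_def, hP, he]
      exact Continuous.aestronglyMeasurable (by fun_prop)
    · simp only [Function.uncurry_def, norm_mul, hPn, he]
      rw [norm_cexp_eq_one (by simp), Complex.norm_real, Real.norm_of_nonneg (by positivity),
        one_mul, one_mul, mul_assoc _ C]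
      gcongr
      exact (hg _ _).trans (mul_le_mul_of_nonneg_left
        (wt_sq_le _) hC)
  have main : ∫ Y, ∫ Z, magIntegrand ε lam A f g (x, ξ) Y Z = ((2 * Real.pi) ^ (2 * d) : ℝ) *
      ∫ y, ∫ z, Complex.exp (Complex.I * dotR ξ (y + z)) * magKernel ε lam A f g x y z := by
    simp only [step1]
    rw [Measure.volume_eq_prod, integral_prod _ hint2]
    simp only [step3]
    simp only [integral_mul_const, integral_const_mul, he, integral_exp_mul_symFT]
    rw [← integral_const_mul]
    refine integral_congr_ae (Filter.Eventually.of_forall fun y => ?_)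
    simp only
    rw [← integral_const_mul]
    refine integral_congr_ae (Filter.Eventually.of_forall fun z => ?_)
    simp only [hP, magKernel]
    push_cast
    ring
  have h2 : ((2 * Real.pi) ^ (2 * d) : ℝ) ≠ 0 := by positivity
  change _ * ∫ Y, ∫ Z, magIntegrand ε lam A f g (x, ξ) Y Z = _
  rw [main, ← mul_assoc, ← Complex.ofReal_mul, inv_mul_cancel₀ h2, Complex.ofReal_one, one_mul]

theorem integrable_wt_comp_smul {d : ℕ} {c : ℝ} (hc : c ≠ 0) :
    Integrable fun x : Vd d => wt (c • x) :=
  integrable_wt.comp_smul hc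

theorem integrable_of_norm_le_wt {d : ℕ} {a : Vd d → ℂ} {C : ℝ} (ha : Continuous a)
    (h : ∀ u, ‖a u‖ ≤ C * wt u) : Integrable a :=
  (integrable_wt.const_mul C).mono' ha.aestronglyMeasurable (Filter.Eventually.of_forall h)

theorem integrable_wt_sq {d : ℕ} : Integrable fun v : Vd d => wt v ^ 2 := by
  refine integrable_wt.mono' (continuous_wt.pow 2).aestronglyMeasurable
    (Filter.Eventually.of_forall fun v => ?_)
  rw [Real.norm_of_nonneg (by positivity)]
  exact wt_sq_le _

theorem memLp_two_of_norm_le_wt {d : ℕ} {a : Vd d → ℂ} {C : ℝ} (ha : Continuous a)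
    (h : ∀ u, ‖a u‖ ≤ C * wt u) : MemLp a 2 := by
  rw [memLp_two_iff_integrable_sq_norm ha.aestronglyMeasurable]
  refine (integrable_wt_sq.const_mul (C ^ 2)).mono' (ha.norm.pow 2).aestronglyMeasurable
    (Filter.Eventually.of_forall fun u => ?_)
  rw [Real.norm_of_nonneg (by positivity), ← mul_pow]
  exact pow_le_pow_left₀ (norm_nonneg _) (h u) 2

theorem integral_norm_sq_fourierVd_le {d : ℕ} {a : Vd d → ℂ} {C : ℝ} (ha : Continuous a)
    (h : ∀ u, ‖a u‖ ≤ C * wt u) :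
    Integrable (fun ξ => ‖fourierVd a ξ‖ ^ 2) ∧
    ∫ ξ, ‖fourierVd a ξ‖ ^ 2 ≤ C ^ 2 * ((2 * Real.pi) ^ d * ∫ u : Vd d, wt u ^ 2) := by
  have h1 := integrable_of_norm_le_wt ha h
  have h2 := memLp_two_of_norm_le_wt ha h
  obtain ⟨hi, he⟩ := integral_conj_fourierVd_mul_fourierVd h1 h2 h1 h2
  simp only [Complex.conj_mul', ← Complex.ofReal_pow] at hi he
  have hR : ∀ F : Vd d → ℝ, ∫ v, (F v : ℂ) = ((∫ v, F v : ℝ) : ℂ) := fun F => integral_ofReal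
  rw [hR, hR, ← Complex.ofReal_mul] at he
  refine ⟨by simpa only [RCLike.re_eq_complex_re, Complex.ofReal_re] using hi.re, ?_⟩
  rw [Complex.ofReal_injective he, mul_left_comm, ← integral_const_mul (C ^ 2)]
  refine mul_le_mul_of_nonneg_left (integral_mono ?_ (integrable_wt_sq.const_mul _) fun u => ?_)
    (by positivity)
  · exact (memLp_two_iff_integrable_sq_norm ha.aestronglyMeasurable).1 h2
  · simp only [← mul_pow]
    exact pow_le_pow_left₀ (norm_nonneg _) (h u) 2

/-- Parseval's identity and the Cauchy-Schwarz inequality for functions dominated by `wt`. -/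
theorem parseval_of_norm_le_wt {d : ℕ} {a b : Vd d → ℂ} {Ca Cb : ℝ} (ha : Continuous a)
    (hb : Continuous b) (hCa : 0 < Ca) (hCb : 0 < Cb) (hab : ∀ u, ‖a u‖ ≤ Ca * wt u)
    (hbb : ∀ u, ‖b u‖ ≤ Cb * wt u) :
    Integrable (fun ξ => (starRingEnd ℂ) (fourierVd a ξ) * fourierVd b ξ) ∧
    ∫ ξ, (starRingEnd ℂ) (fourierVd a ξ) * fourierVd b ξ
      = ((2 * Real.pi) ^ d : ℝ) * ∫ u, (starRingEnd ℂ) (a u) * b u ∧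
    ∫ ξ, ‖(starRingEnd ℂ) (fourierVd a ξ) * fourierVd b ξ‖
      ≤ Ca * Cb * ((2 * Real.pi) ^ d * ∫ u : Vd d, wt u ^ 2) := by
  obtain ⟨hi, he⟩ := integral_conj_fourierVd_mul_fourierVd (integrable_of_norm_le_wt ha hab)
    (memLp_two_of_norm_le_wt ha hab) (integrable_of_norm_le_wt hb hbb)
    (memLp_two_of_norm_le_wt hb hbb)
  refine ⟨hi, he, ?_⟩
  obtain ⟨ia, ea⟩ := integral_norm_sq_fourierVd_le ha hab
  obtain ⟨ib, eb⟩ := integral_norm_sq_fourierVd_le hb hbb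
  set K := (2 * Real.pi) ^ d * ∫ u : Vd d, wt u ^ 2
  calc _ ≤ ∫ ξ, (Cb / (2 * Ca) * ‖fourierVd a ξ‖ ^ 2 + Ca / (2 * Cb) * ‖fourierVd b ξ‖ ^ 2) := by
        refine integral_mono hi.norm ((ia.const_mul _).add (ib.const_mul _)) fun ξ => ?_
        simp only [norm_mul, RCLike.norm_conj]
        have : Cb / (2 * Ca) * ‖fourierVd a ξ‖ ^ 2 + Ca / (2 * Cb) * ‖fourierVd b ξ‖ ^ 2
            - ‖fourierVd a ξ‖ * ‖fourierVd b ξ‖ =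
            (Cb * ‖fourierVd a ξ‖ - Ca * ‖fourierVd b ξ‖) ^ 2 / (2 * Ca * Cb) := by
          field_simp
          ring
        have h2 : 0 ≤ (Cb * ‖fourierVd a ξ‖ - Ca * ‖fourierVd b ξ‖) ^ 2 / (2 * Ca * Cb) := by
          positivity
        linarith
    _ = Cb / (2 * Ca) * (∫ ξ, ‖fourierVd a ξ‖ ^ 2) +
          Ca / (2 * Cb) * ∫ ξ, ‖fourierVd b ξ‖ ^ 2 := by
        rw [integral_add (ia.const_mul _) (ib.const_mul _), integral_const_mul, integral_const_mul]
    _ ≤ Cb / (2 * Ca) * (Ca ^ 2 * K) + Ca / (2 * Cb) * (Cb ^ 2 * K) := by gcongr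
    _ = _ := by field_simp; ring

theorem wt_sq_mul_wt_sq_le {d : ℕ} (y u : Vd d) : wt y ^ 2 * wt (u - y) ^ 2 ≤ wt y * wt u := by
  have h1 : wt y * wt (u - y) ≤ wt u := wt_mul_wt_le (by
    calc ‖u‖ = ‖y + (u - y)‖ := by rw [add_sub_cancel]
      _ ≤ _ := norm_add_le _ _)
  have h2 := wt_pos y
  have h3 := wt_pos (u - y)
  have h4 := wt_le_one (u - y)
  calc wt y ^ 2 * wt (u - y) ^ 2 = wt y * (wt y * wt (u - y)) * wt (u - y) := by ring
    _ ≤ wt y * wt u * 1 := by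
        gcongr
        exact mul_nonneg h2.le (wt_pos u).le
    _ = _ := mul_one _

theorem continuous_partialFT_comp {d : ℕ} (f : 𝓢(Vd d × Vd d, ℂ)) {T : Type*}
    [TopologicalSpace T] {p y : T → Vd d} (hp : Continuous p) (hy : Continuous y) :
    Continuous fun t => partialFT f (p t) (y t) := by
  have h := (continuous_partialFT f).comp (hp.prodMk hy)
  simpa only [Function.comp_def] using h

theorem continuous_magKernel {d : ℕ} {ε lam : ℝ} {A : Vd d → Vd d} (hA : Continuous A)
    (f g : 𝓢(Vd d × Vd d, ℂ)) {T : Type*} [TopologicalSpace T] {x y z : T → Vd d}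
    (hx : Continuous x) (hy : Continuous y) (hz : Continuous z) :
    Continuous fun t => magKernel ε lam A f g (x t) (y t) (z t) := by
  have h2 : Continuous fun t => OmegaB ε lam A (x t - (ε / 2) • (y t + z t))
      (x t + (ε / 2) • (y t - z t)) (x t + (ε / 2) • (y t + z t)) :=
    continuous_OmegaB_comp hA (by fun_prop) (by fun_prop) (by fun_prop)
  have h3 : Continuous fun t => partialFT f (x t - (ε / 2) • z t) (y t) :=
    continuous_partialFT_comp f (by fun_prop) hy
  have h4 : Continuous fun t => partialFT g (x t + (ε / 2) • y t) (z t) :=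
    continuous_partialFT_comp g (by fun_prop) hz
  exact (h2.mul h3).mul h4

theorem exists_magKernel_decay {d : ℕ} (ε lam : ℝ) (A : Vd d → Vd d)
    (f g : 𝓢(Vd d × Vd d, ℂ)) : ∃ C, 0 ≤ C ∧ ∀ x y u,
      ‖magKernel ε lam A f g x y (u - y)‖ ≤ C * (wt y * wt u) := by
  obtain ⟨C, hC, hf⟩ := exists_partialFT_decay f
  obtain ⟨C', hC', hg⟩ := exists_partialFT_decay g
  refine ⟨C * C', mul_nonneg hC hC', fun x y u => ?_⟩
  rw [magKernel, norm_mul, norm_mul, norm_OmegaB, one_mul]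
  calc _ ≤ (C * wt y ^ 2) * (C' * wt (u - y) ^ 2) :=
        mul_le_mul (hf _ _) (hg _ _) (norm_nonneg _) (by positivity)
    _ = C * C' * (wt y ^ 2 * wt (u - y) ^ 2) := by ring
    _ ≤ _ := mul_le_mul_of_nonneg_left (wt_sq_mul_wt_sq_le y u) (mul_nonneg hC hC')

/-- The inverse Fourier transform of the magnetic Weyl product in the momentum variable. -/
def magProfile {d : ℕ} (ε lam : ℝ) (A : Vd d → Vd d) (f g : Vd d × Vd d → ℂ)
    (x u : Vd d) : ℂ := ∫ y, magKernel ε lam A f g x y (u - y)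

theorem continuous_magProfile {d : ℕ} {ε lam : ℝ} {A : Vd d → Vd d} (hA : Continuous A)
    (f g : 𝓢(Vd d × Vd d, ℂ)) :
    Continuous fun q : Vd d × Vd d => magProfile ε lam A f g q.1 q.2 := by
  obtain ⟨C, hC, h⟩ := exists_magKernel_decay ε lam A f g
  refine continuous_of_dominated (bound := fun y => C * wt y) (fun q => ?_) (fun q => ?_)
    (integrable_wt.const_mul C) (Filter.Eventually.of_forall fun y => ?_)
  · exact (continuous_magKernel hA f g (by fun_prop) (by fun_prop)
      (by fun_prop)).aestronglyMeasurable
  · refine Filter.Eventually.of_forall fun y => (h _ _ _).trans ?_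
    exact mul_le_mul_of_nonneg_left (mul_le_of_le_one_right (wt_pos _).le (wt_le_one _)) hC
  · exact continuous_magKernel hA f g (by fun_prop) (by fun_prop) (by fun_prop)

theorem continuous_magProfile_comp {d : ℕ} {ε lam : ℝ} {A : Vd d → Vd d} (hA : Continuous A)
    (f g : 𝓢(Vd d × Vd d, ℂ)) {T : Type*} [TopologicalSpace T] {x u : T → Vd d}
    (hx : Continuous x) (hu : Continuous u) :
    Continuous fun t => magProfile ε lam A f g (x t) (u t) := by
  have h := (continuous_magProfile (ε := ε) (lam := lam) hA f g).comp (hx.prodMk hu)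
  simpa only [Function.comp_def] using h

theorem exists_magProfile_decay {d : ℕ} (ε lam : ℝ) (A : Vd d → Vd d)
    (f g : 𝓢(Vd d × Vd d, ℂ)) : ∃ C, 0 ≤ C ∧ ∀ x u,
      ‖magProfile ε lam A f g x u‖ ≤ C * wt u := by
  obtain ⟨C, hC, h⟩ := exists_magKernel_decay ε lam A f g
  refine ⟨C * ∫ y : Vd d, wt y, mul_nonneg hC (integral_nonneg fun y => (wt_pos y).le),
    fun x u => ?_⟩
  calc _ ≤ ∫ y, C * (wt y * wt u) :=
        norm_integral_le_of_norm_le ((integrable_wt.mul_const _).const_mul C)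
          (Filter.Eventually.of_forall fun y => h x y u)
    _ = _ := by rw [integral_const_mul, integral_mul_const]; ring

theorem magProd_eq_integral_magProfile {d : ℕ} {ε lam : ℝ} {A : Vd d → Vd d} (hA : Continuous A)
    (f g : 𝓢(Vd d × Vd d, ℂ)) (x ξ : Vd d) :
    magProd ε lam A f g (x, ξ) =
      ∫ u, Complex.exp (Complex.I * dotR ξ u) * magProfile ε lam A f g x u := by
  obtain ⟨C, hC, h⟩ := exists_magKernel_decay ε lam A f g
  rw [magProd_eq hA]
  have shift : ∀ y, ∫ z, Complex.exp (Complex.I * dotR ξ (y + z)) * magKernel ε lam A f g x y z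
      = ∫ u, Complex.exp (Complex.I * dotR ξ u) * magKernel ε lam A f g x y (u - y) := fun y => by
    rw [← integral_sub_right_eq_self _ y]
    simp only [add_sub_cancel]
  simp only [shift]
  rw [integral_integral_swap]
  · simp only [integral_const_mul, magProfile]
  · refine ((integrable_wt.mul_prod integrable_wt).const_mul C).mono' ?_
      (Filter.Eventually.of_forall fun q => ?_)
    · have h1 : Continuous fun q : Vd d × Vd d => dotR ξ q.2 :=
        continuous_dotR_comp continuous_const continuous_snd
      have h2 : Continuous fun q : Vd d × Vd d => magKernel ε lam A f g x q.1 (q.2 - q.1) :=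
        continuous_magKernel hA f g (by fun_prop) (by fun_prop) (by fun_prop)
      simp only [Function.uncurry_def]
      exact Continuous.aestronglyMeasurable (by fun_prop)
    · simp only [Function.uncurry_def]
      rw [norm_mul, norm_cexp_eq_one (by simp), one_mul]
      exact h _ _ _

theorem magProd_eq_conj_fourierVd {d : ℕ} {ε lam : ℝ} {A : Vd d → Vd d} (hA : Continuous A)
    (f g : 𝓢(Vd d × Vd d, ℂ)) (x ξ : Vd d) :
    magProd ε lam A f g (x, ξ) = (starRingEnd ℂ)
      (fourierVd (fun u => (starRingEnd ℂ) (magProfile ε lam A f g x u)) ξ) := by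
  rw [magProd_eq_integral_magProfile hA, fourierVd, ← integral_conj]
  refine integral_congr_ae (Filter.Eventually.of_forall fun u => ?_)
  simp only [map_mul, Complex.conj_conj, ← Complex.exp_conj, map_neg, Complex.conj_I, neg_neg,
    Complex.conj_ofReal, dotR_comm ξ u]

/-- The Fourier profile of the magnetic Wigner transform in the momentum variable. -/
def wigProfile {d : ℕ} (ε lam : ℝ) (A : Vd d → Vd d) (φ ψ : Vd d → ℂ) (x u : Vd d) : ℂ :=
  Complex.exp (-Complex.I * lam *
        circAe ε A (ε⁻¹ • x - (2:ℝ)⁻¹ • u) (ε⁻¹ • x + (2:ℝ)⁻¹ • u)) *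
      (starRingEnd ℂ) (φ (ε⁻¹ • x - (2:ℝ)⁻¹ • u)) * ψ (ε⁻¹ • x + (2:ℝ)⁻¹ • u)

theorem mWig_eq_fourierVd {d : ℕ} (ε lam : ℝ) (A : Vd d → Vd d) (φ ψ : Vd d → ℂ) (x ξ : Vd d) :
    mWig ε lam A φ ψ (x, ξ) = fourierVd (wigProfile ε lam A φ ψ x) ξ := by
  simp only [mWig, fourierVd, wigProfile, mul_assoc]

theorem continuous_circAe_comp {d : ℕ} {ε : ℝ} {A : Vd d → Vd d} (hA : Continuous A)
    {T : Type*} [TopologicalSpace T] {a b : T → Vd d} (ha : Continuous a) (hb : Continuous b) :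
    Continuous fun t => circAe ε A (a t) (b t) :=
  continuous_const.mul ((continuous_circA hA).comp ((ha.const_smul ε).prodMk (hb.const_smul ε)))

theorem continuous_wigProfile_comp {d : ℕ} {ε lam : ℝ} {A : Vd d → Vd d} (hA : Continuous A)
    (φ ψ : 𝓢(Vd d, ℂ)) {T : Type*} [TopologicalSpace T] {x u : T → Vd d}
    (hx : Continuous x) (hu : Continuous u) :
    Continuous fun t => wigProfile ε lam A φ ψ (x t) (u t) := by
  have h1 : Continuous fun t =>
      circAe ε A (ε⁻¹ • x t - (2:ℝ)⁻¹ • u t) (ε⁻¹ • x t + (2:ℝ)⁻¹ • u t) :=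
    continuous_circAe_comp hA (by fun_prop) (by fun_prop)
  have h2 := φ.continuous
  have h3 := ψ.continuous
  have h4 : Continuous fun t => (starRingEnd ℂ) (φ (ε⁻¹ • x t - (2:ℝ)⁻¹ • u t)) :=
    Complex.continuous_conj.comp (by fun_prop)
  unfold wigProfile
  fun_prop

theorem wt_sq_mul_wt_sq_le_midpoint {d : ℕ} (x u : Vd d) :
    wt (x - (2:ℝ)⁻¹ • u) ^ 2 * wt (x + (2:ℝ)⁻¹ • u) ^ 2 ≤ wt x * wt u := by
  have h1 : wt (x - (2:ℝ)⁻¹ • u) * wt (x + (2:ℝ)⁻¹ • u) ≤ wt u := wt_mul_wt_le (by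
    calc ‖u‖ = ‖(x + (2:ℝ)⁻¹ • u) - (x - (2:ℝ)⁻¹ • u)‖ := by congr 1; module
      _ ≤ _ := (norm_sub_le _ _).trans_eq (add_comm _ _))
  have h2 : wt (x - (2:ℝ)⁻¹ • u) * wt (x + (2:ℝ)⁻¹ • u) ≤ wt x := wt_mul_wt_le (by
    calc ‖x‖ = ‖(2:ℝ)⁻¹ • ((x - (2:ℝ)⁻¹ • u) + (x + (2:ℝ)⁻¹ • u))‖ := by congr 1; module
      _ ≤ 2⁻¹ * (‖x - (2:ℝ)⁻¹ • u‖ + ‖x + (2:ℝ)⁻¹ • u‖) := by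
          rw [norm_smul, Real.norm_of_nonneg (by norm_num)]
          gcongr
          exact norm_add_le _ _
      _ ≤ _ := by linarith [norm_nonneg (x - (2:ℝ)⁻¹ • u), norm_nonneg (x + (2:ℝ)⁻¹ • u)])
  calc _ = (wt (x - (2:ℝ)⁻¹ • u) * wt (x + (2:ℝ)⁻¹ • u)) *
        (wt (x - (2:ℝ)⁻¹ • u) * wt (x + (2:ℝ)⁻¹ • u)) := by ring
    _ ≤ _ := mul_le_mul h2 h1 (mul_nonneg (wt_pos _).le (wt_pos _).le) (wt_pos _).le

theorem norm_cexp_circAe {d : ℕ} (ε lam : ℝ) (A : Vd d → Vd d) (a b : Vd d) :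
    ‖Complex.exp (-Complex.I * lam * circAe ε A a b)‖ = 1 :=
  norm_cexp_eq_one (by simp)

theorem exists_wigProfile_decay {d : ℕ} (ε lam : ℝ) (A : Vd d → Vd d) (φ ψ : 𝓢(Vd d, ℂ)) :
    ∃ C, 0 ≤ C ∧ ∀ x u, ‖wigProfile ε lam A φ ψ x u‖ ≤ C * (wt (ε⁻¹ • x) * wt u) := by
  obtain ⟨C, hC, hφ⟩ := φ.exists_wt_decay
  obtain ⟨C', hC', hψ⟩ := ψ.exists_wt_decay
  refine ⟨C * C', mul_nonneg hC hC', fun x u => ?_⟩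
  rw [wigProfile, norm_mul, norm_mul, norm_cexp_circAe, one_mul, RCLike.norm_conj]
  calc _ ≤ (C * _) * (C' * _) :=
        mul_le_mul (hφ _) (hψ _) (norm_nonneg _) (by positivity)
    _ = C * C' * (wt (ε⁻¹ • x - (2:ℝ)⁻¹ • u) ^ 2 * wt (ε⁻¹ • x + (2:ℝ)⁻¹ • u) ^ 2) := by ring
    _ ≤ _ := mul_le_mul_of_nonneg_left (wt_sq_mul_wt_sq_le_midpoint _ u) (mul_nonneg hC hC')

theorem stronglyMeasurable_magProd {d : ℕ} {ε lam : ℝ} {A : Vd d → Vd d} (hA : Continuous A)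
    (f g : 𝓢(Vd d × Vd d, ℂ)) : StronglyMeasurable (magProd ε lam A f g) := by
  have h1 : Continuous fun q : (Vd d × Vd d) × Vd d => dotR q.1.2 q.2 :=
    continuous_dotR_comp (by fun_prop) (by fun_prop)
  have h2 : Continuous fun q : (Vd d × Vd d) × Vd d => magProfile ε lam A f g q.1.1 q.2 :=
    continuous_magProfile_comp hA f g (by fun_prop) (by fun_prop)
  have h3 : Continuous fun q : (Vd d × Vd d) × Vd d =>
      Complex.exp (Complex.I * dotR q.1.2 q.2) * magProfile ε lam A f g q.1.1 q.2 := by fun_prop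
  have h4 : StronglyMeasurable fun X : Vd d × Vd d => ∫ u,
      Complex.exp (Complex.I * dotR X.2 u) * magProfile ε lam A f g X.1 u :=
    h3.stronglyMeasurable.integral_prod_right'
  convert h4 using 2 with X
  exact magProd_eq_integral_magProfile hA f g X.1 X.2

theorem stronglyMeasurable_mWig {d : ℕ} {ε lam : ℝ} {A : Vd d → Vd d} (hA : Continuous A)
    (φ ψ : 𝓢(Vd d, ℂ)) : StronglyMeasurable (mWig ε lam A φ ψ) := by
  have h1 : Continuous fun q : (Vd d × Vd d) × Vd d => dotR q.2 q.1.2 :=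
    continuous_dotR_comp (by fun_prop) (by fun_prop)
  have h2 : Continuous fun q : (Vd d × Vd d) × Vd d => wigProfile ε lam A φ ψ q.1.1 q.2 :=
    continuous_wigProfile_comp hA φ ψ (by fun_prop) (by fun_prop)
  have h3 : Continuous fun q : (Vd d × Vd d) × Vd d =>
      Complex.exp (-Complex.I * dotR q.2 q.1.2) * wigProfile ε lam A φ ψ q.1.1 q.2 := by fun_prop
  have h4 : StronglyMeasurable fun X : Vd d × Vd d => ∫ u,
      Complex.exp (-Complex.I * dotR u X.2) * wigProfile ε lam A φ ψ X.1 u :=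
    h3.stronglyMeasurable.integral_prod_right'
  convert h4 using 2 with X
  exact mWig_eq_fourierVd ε lam A φ ψ X.1 X.2

theorem integral_magProd_mul_mWig {d : ℕ} {ε lam : ℝ} (hε : 0 < ε) {A : Vd d → Vd d}
    (hA : Continuous A) (f g : 𝓢(Vd d × Vd d, ℂ)) (φ ψ : 𝓢(Vd d, ℂ)) :
    ∫ X, magProd ε lam A f g X * mWig ε lam A φ ψ X = ((2 * Real.pi) ^ d : ℝ) *
      ∫ x, ∫ u, magProfile ε lam A f g x u * wigProfile ε lam A φ ψ x u := by
  obtain ⟨C, hC, hf⟩ := exists_magProfile_decay ε lam A f g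
  obtain ⟨C', hC', hw⟩ := exists_wigProfile_decay ε lam A φ ψ
  have ha : ∀ x, Continuous fun u => (starRingEnd ℂ) (magProfile ε lam A f g x u) := fun x =>
    Complex.continuous_conj.comp (continuous_magProfile_comp hA f g continuous_const continuous_id)
  have hb : ∀ x, Continuous (wigProfile ε lam A φ ψ x) := fun x =>
    continuous_wigProfile_comp hA φ ψ continuous_const continuous_id
  have key := fun x : Vd d => parseval_of_norm_le_wt (Ca := C + 1)
    (Cb := (C' + 1) * wt (ε⁻¹ • x)) (ha x) (hb x)
    (by positivity) (mul_pos (by positivity) (wt_pos _))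
    (fun u => by
      rw [RCLike.norm_conj]
      exact (hf x u).trans (mul_le_mul_of_nonneg_right (by linarith) (wt_pos _).le))
    (fun u => by
      rw [mul_assoc]
      exact (hw x u).trans (mul_le_mul_of_nonneg_right (by linarith)
        (mul_nonneg (wt_pos _).le (wt_pos _).le)))
  simp only [← magProd_eq_conj_fourierVd hA, ← mWig_eq_fourierVd, Complex.conj_conj] at key
  have hmeas : StronglyMeasurable fun X => magProd ε lam A f g X * mWig ε lam A φ ψ X :=
    (stronglyMeasurable_magProd hA f g).mul (stronglyMeasurable_mWig hA φ ψ)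
  have hint : Integrable (fun X => magProd ε lam A f g X * mWig ε lam A φ ψ X)
      (volume.prod volume) := by
    rw [integrable_prod_iff hmeas.aestronglyMeasurable]
    refine ⟨Filter.Eventually.of_forall fun x => (key x).1, ?_⟩
    refine ((integrable_wt_comp_smul (inv_ne_zero hε.ne')).const_mul ((C + 1) * (C' + 1) *
      ((2 * Real.pi) ^ d * ∫ u : Vd d, wt u ^ 2))).mono'
      hmeas.norm.integral_prod_right'.aestronglyMeasurable
      (Filter.Eventually.of_forall fun x => ?_)
    rw [Real.norm_of_nonneg (integral_nonneg fun _ => norm_nonneg _)]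
    refine (key x).2.2.trans_eq ?_
    ring
  rw [Measure.volume_eq_prod, integral_prod _ hint, ← integral_const_mul]
  exact integral_congr_ae (Filter.Eventually.of_forall fun x => (key x).2.1)

/-- The integral kernel of the magnetic Weyl quantization. -/
def opKernel {d : ℕ} (ε lam : ℝ) (A : Vd d → Vd d) (f : Vd d × Vd d → ℂ) (a b : Vd d) : ℂ :=
  Complex.exp (-Complex.I * lam * circAe ε A a b) * partialFT f ((ε / 2) • (a + b)) (b - a)

theorem mOp_eq_integral_opKernel {d : ℕ} (ε lam : ℝ) (A : Vd d → Vd d) (f : Vd d × Vd d → ℂ)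
    (χ : Vd d → ℂ) (x : Vd d) :
    mOp ε lam A f χ x = ∫ y, opKernel ε lam A f x y * χ y := by
  rw [mOp, ← integral_const_mul]
  refine integral_congr_ae (Filter.Eventually.of_forall fun y => ?_)
  simp only [opKernel, partialFT, fourierVd]
  have h : ∀ η, Complex.exp (-Complex.I * dotR (y - x) η) *
      Complex.exp (-Complex.I * lam * circAe ε A x y) * f ((ε / 2) • (x + y), η) * χ y =
      (Complex.exp (-Complex.I * lam * circAe ε A x y) * χ y) *
        (Complex.exp (-Complex.I * dotR η (y - x)) * f ((ε / 2) • (x + y), η)) := fun η => by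
    rw [dotR_comm η]
    ring
  simp only [h, integral_const_mul]
  ring

theorem magKernel_mul_wigProfile {d : ℕ} {ε lam : ℝ} (hε : ε ≠ 0) (A : Vd d → Vd d)
    (f g : Vd d × Vd d → ℂ) (φ ψ : Vd d → ℂ) (a u y : Vd d) :
    magKernel ε lam A f g (ε • (a + (2:ℝ)⁻¹ • u)) y (u - y) *
        wigProfile ε lam A φ ψ (ε • (a + (2:ℝ)⁻¹ • u)) u =
      (starRingEnd ℂ) (φ a) * opKernel ε lam A f a (a + y) *
        (opKernel ε lam A g (a + y) (a + u) * ψ (a + u)) := by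
  have h1 : ε • (a + (2:ℝ)⁻¹ • u) - (ε / 2) • (y + (u - y)) = ε • a := by module
  have h2 : ε • (a + (2:ℝ)⁻¹ • u) + (ε / 2) • (y - (u - y)) = ε • (a + y) := by module
  have h3 : ε • (a + (2:ℝ)⁻¹ • u) + (ε / 2) • (y + (u - y)) = ε • (a + u) := by module
  have h4 : ε • (a + (2:ℝ)⁻¹ • u) - (ε / 2) • (u - y) = (ε / 2) • (a + (a + y)) := by module
  have h5 : ε • (a + (2:ℝ)⁻¹ • u) + (ε / 2) • y = (ε / 2) • ((a + y) + (a + u)) := by module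
  have h6 : ε⁻¹ • ε • (a + (2:ℝ)⁻¹ • u) - (2:ℝ)⁻¹ • u = a := by
    rw [inv_smul_smul₀ hε, add_sub_cancel_right]
  have h7 : ε⁻¹ • ε • (a + (2:ℝ)⁻¹ • u) + (2:ℝ)⁻¹ • u = a + u := by
    rw [inv_smul_smul₀ hε]
    module
  have key : OmegaB ε lam A (ε • a) (ε • (a + y)) (ε • (a + u)) *
      Complex.exp (-Complex.I * lam * circAe ε A a (a + u)) =
      Complex.exp (-Complex.I * lam * circAe ε A a (a + y)) *
        Complex.exp (-Complex.I * lam * circAe ε A (a + y) (a + u)) := by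
    rw [OmegaB, ← Complex.exp_add, ← Complex.exp_add]
    congr 1
    simp only [circAe, circA_swap A (ε • a) (ε • (a + u))]
    push_cast
    ring
  rw [magKernel, wigProfile, h1, h2, h3, h4, h5, h6, h7, opKernel, opKernel,
    add_sub_cancel_left, add_sub_add_left_eq_sub]
  linear_combination (partialFT f ((ε / 2) • (a + (a + y))) y *
    partialFT g ((ε / 2) • ((a + y) + (a + u))) (u - y) * (starRingEnd ℂ) (φ a) * ψ (a + u)) * key

theorem continuous_opKernel_comp {d : ℕ} {ε lam : ℝ} {A : Vd d → Vd d} (hA : Continuous A)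
    (f : 𝓢(Vd d × Vd d, ℂ)) {T : Type*} [TopologicalSpace T] {a b : T → Vd d}
    (ha : Continuous a) (hb : Continuous b) :
    Continuous fun t => opKernel ε lam A f (a t) (b t) := by
  have h1 : Continuous fun t => circAe ε A (a t) (b t) := continuous_circAe_comp hA ha hb
  have h2 : Continuous fun t => partialFT f ((ε / 2) • (a t + b t)) (b t - a t) :=
    continuous_partialFT_comp f (by fun_prop) (by fun_prop)
  unfold opKernel
  fun_prop

theorem exists_opKernel_decay {d : ℕ} (ε lam : ℝ) (A : Vd d → Vd d) (f : 𝓢(Vd d × Vd d, ℂ)) :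
    ∃ C, 0 ≤ C ∧ ∀ a b, ‖opKernel ε lam A f a b‖ ≤ C * wt (b - a) := by
  obtain ⟨C, hC, hf⟩ := exists_partialFT_decay f
  refine ⟨C, hC, fun a b => ?_⟩
  rw [opKernel, norm_mul, norm_cexp_circAe, one_mul]
  exact (hf _ _).trans (mul_le_mul_of_nonneg_left
    (wt_sq_le _) hC)

theorem exists_wigProfile_decay_left {d : ℕ} {ε : ℝ} (hε : ε ≠ 0) (lam : ℝ) (A : Vd d → Vd d)
    (φ ψ : 𝓢(Vd d, ℂ)) : ∃ C, 0 ≤ C ∧ ∀ a u,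
      ‖wigProfile ε lam A φ ψ (ε • (a + (2:ℝ)⁻¹ • u)) u‖ ≤ C * wt a := by
  obtain ⟨C, hC, hφ⟩ := φ.exists_wt_decay
  obtain ⟨C', hC', hψ⟩ := ψ.exists_wt_decay
  refine ⟨C * C', mul_nonneg hC hC', fun a u => ?_⟩
  rw [wigProfile, norm_mul, norm_mul, norm_cexp_circAe, one_mul, RCLike.norm_conj,
    inv_smul_smul₀ hε, add_sub_cancel_right]
  set c := a + (2:ℝ)⁻¹ • u + (2:ℝ)⁻¹ • u
  calc _ ≤ (C * wt a) * (C' * 1) :=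
        mul_le_mul ((hφ _).trans (mul_le_mul_of_nonneg_left (wt_sq_le _) hC))
          ((hψ _).trans (mul_le_mul_of_nonneg_left ((wt_sq_le _).trans (wt_le_one _)) hC'))
          (norm_nonneg _) (mul_nonneg hC (wt_pos _).le)
    _ = _ := by ring

theorem continuous_profile_mul_comp {d : ℕ} {ε lam : ℝ} {A : Vd d → Vd d} (hA : Continuous A)
    (f g : 𝓢(Vd d × Vd d, ℂ)) (φ ψ : 𝓢(Vd d, ℂ)) {T : Type*} [TopologicalSpace T]
    {x u : T → Vd d} (hx : Continuous x) (hu : Continuous u) :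
    Continuous fun t =>
      magProfile ε lam A f g (x t) (u t) * wigProfile ε lam A φ ψ (x t) (u t) :=
  (continuous_magProfile_comp hA f g hx hu).mul (continuous_wigProfile_comp hA φ ψ hx hu)

theorem integral_comp_smul_add {d : ℕ} {ε : ℝ} (hε : 0 < ε) (F : Vd d → ℂ) (v : Vd d) :
    ∫ x, F x = (ε ^ d : ℝ) * ∫ a, F (ε • (a + v)) := by
  rw [integral_add_right_eq_self (fun a => F (ε • a)) v, Measure.integral_comp_smul,
    Module.finrank_fin_fun, abs_of_pos (by positivity), Complex.real_smul, ← mul_assoc,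
    ← Complex.ofReal_mul, mul_inv_cancel₀ (by positivity), Complex.ofReal_one, one_mul]

theorem integral_magProfile_mul_wigProfile {d : ℕ} {ε lam : ℝ} (hε : 0 < ε) {A : Vd d → Vd d}
    (hA : Continuous A) (f g : 𝓢(Vd d × Vd d, ℂ)) (φ ψ : 𝓢(Vd d, ℂ)) :
    ∫ x, ∫ u, magProfile ε lam A f g x u * wigProfile ε lam A φ ψ x u =
      (ε ^ d : ℝ) * ∫ a, ∫ u, magProfile ε lam A f g (ε • (a + (2:ℝ)⁻¹ • u)) u *
        wigProfile ε lam A φ ψ (ε • (a + (2:ℝ)⁻¹ • u)) u := by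
  obtain ⟨C, hC, hf⟩ := exists_magProfile_decay ε lam A f g
  obtain ⟨C', hC', hw⟩ := exists_wigProfile_decay ε lam A φ ψ
  obtain ⟨C'', hC'', hl⟩ := exists_wigProfile_decay_left hε.ne' lam A φ ψ
  have int1 : Integrable (Function.uncurry fun x u =>
      magProfile ε lam A f g x u * wigProfile ε lam A φ ψ x u) (volume.prod volume) := by
    have hcont : Continuous (Function.uncurry fun x u =>
        magProfile ε lam A f g x u * wigProfile ε lam A φ ψ x u) :=
      continuous_profile_mul_comp hA f g φ ψ continuous_fst continuous_snd
    refine ((integrable_wt_comp_smul (inv_ne_zero hε.ne')).mul_prod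
      (integrable_wt.const_mul (C * C'))).mono' hcont.aestronglyMeasurable
      (Filter.Eventually.of_forall fun q => ?_)
    simp only [Function.uncurry_def, norm_mul]
    have h0 := (wt_pos q.2).le
    have h1 := (wt_pos (ε⁻¹ • q.1)).le
    calc _ ≤ (C * 1) * (C' * (wt (ε⁻¹ • q.1) * wt q.2)) :=
          mul_le_mul ((hf _ _).trans (mul_le_mul_of_nonneg_left (wt_le_one _) hC)) (hw _ _)
            (norm_nonneg _) (by positivity)
      _ = _ := by ring
  have int2 : Integrable (Function.uncurry fun a u =>
      magProfile ε lam A f g (ε • (a + (2:ℝ)⁻¹ • u)) u *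
        wigProfile ε lam A φ ψ (ε • (a + (2:ℝ)⁻¹ • u)) u) (volume.prod volume) := by
    have hx : Continuous fun q : Vd d × Vd d => ε • (q.1 + (2:ℝ)⁻¹ • q.2) := by fun_prop
    have hcont : Continuous (Function.uncurry fun a u =>
        magProfile ε lam A f g (ε • (a + (2:ℝ)⁻¹ • u)) u *
          wigProfile ε lam A φ ψ (ε • (a + (2:ℝ)⁻¹ • u)) u) :=
      continuous_profile_mul_comp hA f g φ ψ hx continuous_snd
    refine (integrable_wt.mul_prod (integrable_wt.const_mul (C * C''))).mono'
      hcont.aestronglyMeasurable (Filter.Eventually.of_forall fun q => ?_)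
    simp only [Function.uncurry_def, norm_mul]
    calc _ ≤ (C * wt q.2) * (C'' * wt q.1) :=
          mul_le_mul (hf _ _) (hl _ _) (norm_nonneg _) (mul_nonneg hC (wt_pos _).le)
      _ = _ := by ring
  rw [integral_integral_swap int1, integral_integral_swap int2, ← integral_const_mul]
  refine integral_congr_ae (Filter.Eventually.of_forall fun u => ?_)
  exact integral_comp_smul_add hε
    (fun x => magProfile ε lam A f g x u * wigProfile ε lam A φ ψ x u) ((2:ℝ)⁻¹ • u)

theorem integral_profile_eq_integral_opKernel {d : ℕ} {ε lam : ℝ} (hε : ε ≠ 0)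
    {A : Vd d → Vd d} (hA : Continuous A) (f g : 𝓢(Vd d × Vd d, ℂ)) (φ ψ : 𝓢(Vd d, ℂ))
    (a : Vd d) :
    ∫ u, magProfile ε lam A f g (ε • (a + (2:ℝ)⁻¹ • u)) u *
        wigProfile ε lam A φ ψ (ε • (a + (2:ℝ)⁻¹ • u)) u =
      (starRingEnd ℂ) (φ a) * mOp ε lam A f (mOp ε lam A g ψ) a := by
  set G : Vd d → Vd d → ℂ := fun b c => (starRingEnd ℂ) (φ a) * opKernel ε lam A f a b *
    (opKernel ε lam A g b c * ψ c) with hG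
  have h1 : ∀ u, magProfile ε lam A f g (ε • (a + (2:ℝ)⁻¹ • u)) u *
      wigProfile ε lam A φ ψ (ε • (a + (2:ℝ)⁻¹ • u)) u = ∫ b, G b (a + u) := fun u => by
    rw [magProfile, ← integral_mul_const, ← integral_add_left_eq_self (fun b => G b (a + u)) a]
    simp only [magKernel_mul_wigProfile hε, hG]
  have hGint : Integrable (Function.uncurry fun c b => G b c) (volume.prod volume) := by
    obtain ⟨C, hC, hf⟩ := exists_opKernel_decay ε lam A f
    obtain ⟨C', hC', hg⟩ := exists_opKernel_decay ε lam A g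
    obtain ⟨C'', hC'', hψ⟩ := ψ.exists_wt_decay
    have h2 : Continuous fun q : Vd d × Vd d => opKernel ε lam A f a q.2 :=
      continuous_opKernel_comp hA f continuous_const continuous_snd
    have h3 : Continuous fun q : Vd d × Vd d => opKernel ε lam A g q.2 q.1 :=
      continuous_opKernel_comp hA g continuous_snd continuous_fst
    have h4 := ψ.continuous
    refine ((integrable_wt.const_mul (‖φ a‖ * C * C' * C'')).mul_prod
      (integrable_wt.comp_sub_right a)).mono' ?_ (Filter.Eventually.of_forall fun q => ?_)
    · simp only [Function.uncurry_def, hG]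
      exact Continuous.aestronglyMeasurable (by fun_prop)
    · simp only [Function.uncurry_def, hG, norm_mul, RCLike.norm_conj]
      have h5 := (wt_pos (q.2 - a)).le
      have h6 := (wt_pos q.1).le
      have h7 : ‖opKernel ε lam A g q.2 q.1‖ ≤ C' * 1 :=
        (hg _ _).trans (mul_le_mul_of_nonneg_left (wt_le_one _) hC')
      have h8 : ‖ψ q.1‖ ≤ C'' * wt q.1 :=
        (hψ _).trans (mul_le_mul_of_nonneg_left (wt_sq_le _) hC'')
      calc _ ≤ ‖φ a‖ * (C * wt (q.2 - a)) * ((C' * 1) * (C'' * wt q.1)) := by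
            gcongr
            exact hf _ _
        _ = _ := by ring
  simp only [h1]
  rw [integral_add_left_eq_self (fun c => ∫ b, G b c) a, integral_integral_swap hGint,
    mOp_eq_integral_opKernel, ← integral_const_mul]
  simp only [hG, integral_const_mul, mOp_eq_integral_opKernel, mul_assoc]

/-- The magnetic Weyl product converges absolutely and represents operator composition:
`⟨φ, Op^A_{ε,λ}(f) Op^A_{ε,λ}(g) ψ⟩ = (2πε)^{-d} ∫ (f⋆g)(X) W^A_{ε,λ}(φ,ψ)(X) dX`. -/
theorem statement7 (d : ℕ) (hd : 1 ≤ d) (ε : ℝ) (hε : 0 < ε) (lam : ℝ)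
    (A : Vd d → Vd d) (hA : ∀ l, CPol fun x : Vd d => A x l)
    (f g : SchwartzMap (Vd d × Vd d) ℂ) :
    (∀ X : Vd d × Vd d,
      Integrable (fun YZ : (Vd d × Vd d) × (Vd d × Vd d) =>
        Complex.exp (Complex.I * symp X (YZ.1 + YZ.2)) *
          Complex.exp (Complex.I * (ε / 2) * symp YZ.1 YZ.2) *
          OmegaB ε lam A (X.1 - (ε / 2) • (YZ.1.1 + YZ.2.1))
            (X.1 + (ε / 2) • (YZ.1.1 - YZ.2.1)) (X.1 + (ε / 2) • (YZ.1.1 + YZ.2.1)) *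
          symFT (⇑f) YZ.1 * symFT (⇑g) YZ.2)) ∧
    ∀ (φ ψ : SchwartzMap (Vd d) ℂ),
      (∫ x : Vd d, (starRingEnd ℂ) (φ x) * mOp ε lam A (⇑f) (mOp ε lam A (⇑g) (⇑ψ)) x)
        = (((2 * Real.pi * ε) ^ d)⁻¹ : ℝ) *
            ∫ X : Vd d × Vd d, magProd ε lam A (⇑f) (⇑g) X * mWig ε lam A (⇑φ) (⇑ψ) X := by
  have hAc : Continuous A := continuous_pi fun l => (hA l).1.continuous
  refine ⟨fun X => integrable_magIntegrand hAc f g X, fun φ ψ => ?_⟩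
  have hc : ((2 * Real.pi * ε) ^ d)⁻¹ * ((2 * Real.pi) ^ d * ε ^ d) = 1 := by
    rw [← mul_pow]
    exact inv_mul_cancel₀ (by positivity)
  rw [integral_magProd_mul_mWig hε hAc, integral_magProfile_mul_wigProfile hε hAc]
  simp only [integral_profile_eq_integral_opKernel hε.ne' hAc]
  rw [← mul_assoc, ← mul_assoc, ← Complex.ofReal_mul, ← Complex.ofReal_mul, mul_assoc, hc,
    Complex.ofReal_one, one_mul]
end
end
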